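/- arXiv:1006.4083 — 7 statements merged into one kernel-verified Lean document; each statement's English description precedes it below -/
import Mathlib

section
/- (Komlós-type theorem) Let (Ω,ℱ,P) be a probability space and (x^ν)_{ν=1}^∞ a sequence of measurable functions Ω → ℝ^n that is almost surely bounded, i.e. sup_ν |x^ν(ω)| < ∞ for P-almost every ω. Then there exist a measurable function x : Ω → ℝ^n and a sequence (x̄^ν)_{ν=1}^∞ such that each x̄^ν is a (finite) convex combination of the functions {x^μ : μ ≥ ν} and x̄^ν(ω) → x(ω) for P-almost every ω. -/
open MeasureTheory Filter Topology

/-- A point of the convex hull of the values of `y` on a set of indices is a finite convex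
combination indexed by distinct elements of that set. -/
theorem exists_finset_weights_of_mem_convexHull_image {ι E : Type*} [AddCommGroup E] [Module ℝ E]
    {y : ι → E} {A : Set ι} {z : E} (hz : z ∈ convexHull ℝ (y '' A)) :
    ∃ (s : Finset ι) (lam : ι → ℝ), (∀ i ∈ s, i ∈ A) ∧ (∀ i ∈ s, 0 ≤ lam i) ∧
      (∑ i ∈ s, lam i) = 1 ∧ z = ∑ i ∈ s, lam i • y i := by
  classical
  have : Nonempty ι :=
    (Set.image_nonempty.1 (convexHull_nonempty_iff.1 ⟨z, hz⟩)).to_type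
  rw [convexHull_eq] at hz
  obtain ⟨κ, t, w, v, hw, hw1, hv, rfl⟩ := hz
  choose! f hfA hf using hv
  have hmaps : ∀ i ∈ t, f i ∈ t.image f := fun i hi => Finset.mem_image_of_mem f hi
  refine ⟨t.image f, fun a => ∑ i ∈ t with f i = a, w i, ?_, ?_, ?_, ?_⟩
  · intro a ha
    obtain ⟨i, hi, rfl⟩ := Finset.mem_image.1 ha
    exact hfA i hi
  · intro a _
    exact Finset.sum_nonneg fun i hi => hw i (Finset.mem_filter.1 hi).1
  · rw [Finset.sum_fiberwise_of_maps_to hmaps, hw1]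
  · rw [Finset.centerMass_eq_of_sum_1 _ _ hw1, ← Finset.sum_fiberwise_of_maps_to hmaps]
    refine Finset.sum_congr rfl fun a _ => ?_
    rw [Finset.sum_smul]
    refine Finset.sum_congr rfl fun i hi => ?_
    obtain ⟨hit, rfl⟩ := Finset.mem_filter.1 hi
    rw [hf i hit]

/-- In a Hilbert space, any bounded sequence has convex combinations of its tails that
converge in norm. -/
theorem exists_tendsto_mem_convexHull_tail {E : Type*} [NormedAddCommGroup E]
    [InnerProductSpace ℝ E] [CompleteSpace E] (y : ℕ → E) {R : ℝ} (hR : ∀ k, ‖y k‖ ≤ R) :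
    ∃ (z : ℕ → E) (l : E), (∀ k, z k ∈ convexHull ℝ (y '' Set.Ici k)) ∧
      Tendsto z atTop (𝓝 l) := by
  set C : ℕ → Set E := fun k => convexHull ℝ (y '' Set.Ici k)
  have hne : ∀ k, (C k).Nonempty := fun k =>
    ⟨y k, subset_convexHull ℝ _ ⟨k, Set.self_mem_Ici, rfl⟩⟩
  have hanti : ∀ {i j}, i ≤ j → C j ⊆ C i := fun hij =>
    convexHull_mono (Set.image_mono (Set.Ici_subset_Ici.2 hij))
  set d : ℕ → ℝ := fun k => Metric.infDist 0 (C k)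
  have hd0 : ∀ k, 0 ≤ d k := fun k => Metric.infDist_nonneg
  have hd_le : ∀ k, ∀ v ∈ C k, d k ≤ ‖v‖ := fun k v hv => by
    simpa using Metric.infDist_le_dist_of_mem (x := (0 : E)) hv
  have hmono : Monotone d := fun i j hij =>
    Metric.infDist_le_infDist_of_subset (hanti hij) (hne j)
  have hbdd : BddAbove (Set.range d) := by
    refine ⟨R, ?_⟩
    rintro _ ⟨k, rfl⟩
    exact (hd_le k _ (subset_convexHull ℝ _ ⟨k, Set.self_mem_Ici, rfl⟩)).trans (hR k)
  have hlim := tendsto_atTop_ciSup hmono hbdd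
  set D := ⨆ k, d k
  have hdD : ∀ k, d k ≤ D := fun k => le_ciSup hbdd k
  have hex : ∀ k : ℕ, ∃ v ∈ C k, ‖v‖ < d k + 1 / ((k : ℝ) + 1) := fun k => by
    have h : d k < d k + 1 / ((k : ℝ) + 1) := lt_add_of_pos_right _ (by positivity)
    simpa using (Metric.infDist_lt_iff (hne k)).1 h
  choose z hzC hz using hex
  have hzN : ∀ N k : ℕ, N ≤ k → ‖z k‖ ≤ D + 1 / ((N : ℝ) + 1) := fun N k hNk => by
    have h1 : 1 / ((k : ℝ) + 1) ≤ 1 / ((N : ℝ) + 1) := by gcongr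
    linarith [hz k, hdD k]
  have hcauchy : CauchySeq z := by
    refine cauchySeq_of_le_tendsto_0
      (fun N : ℕ => √(4 * ((D + 1 / ((N : ℝ) + 1)) ^ 2 - d N ^ 2))) ?_ ?_
    · intro i j N hi hj
      have hmid : (1 / 2 : ℝ) • z i + (1 / 2 : ℝ) • z j ∈ C N :=
        convex_convexHull ℝ _ (hanti hi (hzC i)) (hanti hj (hzC j))
          (by norm_num) (by norm_num) (by norm_num)
      have h1 := hd_le N _ hmid
      rw [← smul_add, norm_smul, Real.norm_of_nonneg (by norm_num)] at h1
      have h2 := parallelogram_law_with_norm ℝ (z i) (z j)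
      have h3 : ‖z i‖ ^ 2 ≤ (D + 1 / ((N : ℝ) + 1)) ^ 2 := by gcongr; exact hzN N i hi
      have h4 : ‖z j‖ ^ 2 ≤ (D + 1 / ((N : ℝ) + 1)) ^ 2 := by gcongr; exact hzN N j hj
      have h5 : d N ^ 2 ≤ (1 / 2 * ‖z i + z j‖) ^ 2 := by gcongr; exact hd0 N
      rw [dist_eq_norm]
      apply Real.le_sqrt_of_sq_le
      nlinarith
    · have h := ((((tendsto_const_nhds (x := D)).add
        (tendsto_one_div_add_atTop_nhds_zero_nat (𝕜 := ℝ))).pow 2).sub (hlim.pow 2)).const_mul 4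
      simpa using h.sqrt
  obtain ⟨l, hl⟩ := cauchySeq_tendsto_of_complete hcauchy
  exact ⟨z, l, hzC, hl⟩

/-- **Komlós-type theorem**: an almost surely bounded sequence of measurable `ℝ^n`-valued
functions admits convex combinations of its tails converging almost surely. -/
theorem komlos {Ω : Type*} [MeasurableSpace Ω] (P : Measure Ω) [IsProbabilityMeasure P]
    (n : ℕ) (x : ℕ → Ω → EuclideanSpace ℝ (Fin n))
    (hmeas : ∀ ν, Measurable (x ν))
    (hbdd : ∀ᵐ ω ∂P, ∃ C : ℝ, ∀ ν, ‖x ν ω‖ ≤ C) :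
    ∃ (xbar : ℕ → Ω → EuclideanSpace ℝ (Fin n)) (xlim : Ω → EuclideanSpace ℝ (Fin n)),
      Measurable xlim ∧
      (∀ ν, ∃ (s : Finset ℕ) (lam : ℕ → ℝ),
        (∀ μ ∈ s, ν ≤ μ) ∧ (∀ μ ∈ s, 0 ≤ lam μ) ∧ (∑ μ ∈ s, lam μ) = 1 ∧
        xbar ν = fun ω => ∑ μ ∈ s, lam μ • x μ ω) ∧
      ∀ᵐ ω ∂P, Tendsto (fun ν => xbar ν ω) atTop (nhds (xlim ω)) := by
  set M : Ω → ℝ := fun ω => 1 + (⨆ ν, ‖x ν ω‖ₑ).toReal with hM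
  have hMmeas : Measurable M :=
    (Measurable.iSup fun ν => (hmeas ν).enorm).ennreal_toReal.const_add 1
  have hMpos : ∀ ω, 0 < M ω := fun ω => by positivity
  have hxM : ∀ᵐ ω ∂P, ∀ ν, ‖x ν ω‖ ≤ M ω := by
    filter_upwards [hbdd] with ω ⟨C, hC⟩ ν
    have htop : (⨆ ν, ‖x ν ω‖ₑ) ≠ ⊤ := by
      refine ne_top_of_le_ne_top (ENNReal.ofReal_ne_top (r := C)) (iSup_le fun k => ?_)
      rw [← ofReal_norm]
      exact ENNReal.ofReal_le_ofReal (hC k)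
    have h := ENNReal.toReal_mono htop (le_iSup (fun ν => ‖x ν ω‖ₑ) ν)
    rw [toReal_enorm] at h
    simp only [hM]
    linarith
  set y : ℕ → Ω → EuclideanSpace ℝ (Fin n) := fun ν ω => (M ω)⁻¹ • x ν ω with hy
  have hymeas : ∀ ν, Measurable (y ν) := fun ν => hMmeas.inv.smul (hmeas ν)
  have hy1 : ∀ ν, ∀ᵐ ω ∂P, ‖y ν ω‖ ≤ 1 := fun ν => by
    filter_upwards [hxM] with ω hω
    rw [hy, norm_smul, norm_inv, Real.norm_of_nonneg (hMpos ω).le, inv_mul_le_one₀ (hMpos ω)]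
    exact hω ν
  have hyLp : ∀ ν, MemLp (y ν) 2 P := fun ν =>
    MemLp.of_bound (hymeas ν).aestronglyMeasurable 1 (hy1 ν)
  have hynorm : ∀ ν, ‖(hyLp ν).toLp (y ν)‖ ≤ 1 := fun ν => by
    have h := Lp.norm_le_of_ae_bound (f := (hyLp ν).toLp (y ν)) zero_le_one (by
      filter_upwards [hy1 ν, (hyLp ν).coeFn_toLp] with ω h1 h2
      rwa [h2])
    exact h.trans_eq (by simp [measureUnivNNReal])
  obtain ⟨z, l, hz, hzl⟩ := exists_tendsto_mem_convexHull_tail _ hynorm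
  obtain ⟨k, hk, hkl⟩ := (tendstoInMeasure_of_tendsto_Lp hzl).exists_seq_tendsto_ae
  choose s lam hs hlam hsum hzeq using
    fun ν => exists_finset_weights_of_mem_convexHull_image (hz ν)
  refine ⟨fun ν ω => ∑ μ ∈ s (k ν), lam (k ν) μ • x μ ω, fun ω => M ω • l ω,
    hMmeas.smul (Lp.stronglyMeasurable l).measurable, fun ν => ⟨s (k ν), lam (k ν), ?_,
      hlam _, hsum _, rfl⟩, ?_⟩
  · exact fun μ hμ => (hk.le_apply).trans (hs _ μ hμ)
  · have hzae : ∀ᵐ ω ∂P, ∀ ν, z ν ω = ∑ μ ∈ s ν, lam ν μ • y μ ω := by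
      refine ae_all_iff.2 fun ν => ?_
      have h1 : ∀ᵐ ω ∂P, ∀ μ, (lam ν μ • (hyLp μ).toLp (y μ)) ω = lam ν μ • y μ ω := by
        refine ae_all_iff.2 fun μ => ?_
        filter_upwards [Lp.coeFn_smul (lam ν μ) ((hyLp μ).toLp (y μ)),
          (hyLp μ).coeFn_toLp] with ω h1 h2
        rw [h1, Pi.smul_apply, h2]
      have h2 := Lp.coeFn_finsetSum (s ν) fun μ => lam ν μ • (hyLp μ).toLp (y μ)
      rw [← hzeq ν] at h2
      filter_upwards [h1, h2] with ω h1 h2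
      rw [h2, Finset.sum_apply]
      exact Finset.sum_congr rfl fun μ _ => h1 μ
    filter_upwards [hkl, hzae] with ω h1 h2
    refine (h1.const_smul (M ω)).congr fun ν => ?_
    rw [h2, Finset.smul_sum]
    refine Finset.sum_congr rfl fun μ _ => ?_
    rw [hy, smul_comm, smul_inv_smul₀ (hMpos ω).ne']
end

section
/- Let (Ω,ℱ,P) be a probability space with a filtration (ℱ_t)_{t=0}^T and let 𝒩 be the space of adapted processes x=(x_t)_{t=0}^T with x_t ∈ L^0(Ω,ℱ_t,P;ℝ^{n_t}). Let (x^ν)_{ν=1}^∞ ⊂ 𝒩 be almost surely bounded, i.e. sup_ν |x^ν(ω)| < ∞ P-a.s. Then there exist a sequence (τ^ν)_{ν=1}^∞ of ℱ_T-measurable, positive-integer-valued random variables with τ^ν(ω) < τ^{ν+1}(ω) for all ω and ν, and an x ∈ 𝒩, such that x^{τ^ν}(ω) := x^{τ^ν(ω)}(ω) converges to x(ω) for P-almost every ω. -/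
open MeasureTheory Filter Topology

/-- Evaluating a sequence of measurable functions at a measurable random index is measurable. -/
theorem measurable_random_index {Ω β : Type*} [MeasurableSpace Ω] [MeasurableSpace β]
    {y : ℕ → Ω → β} {N : Ω → ℕ} (hy : ∀ n, Measurable (y n)) (hN : Measurable N) :
    Measurable fun ω => y (N ω) ω :=
  (measurable_from_prod_countable_right (f := fun q : ℕ × Ω => y q.1 q.2) hy).comp
    (hN.prodMk measurable_id)

/-- Given a measurable random index, there is a larger one which satisfies a given measurable
property at every outcome where that property holds frequently. -/
theorem exists_measurable_next_index {Ω : Type*} [MeasurableSpace Ω] {q : Ω → ℕ → Prop}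
    (hq : ∀ n, MeasurableSet {ω | q ω n}) {N : Ω → ℕ} (hN : Measurable N) :
    ∃ N' : Ω → ℕ, Measurable N' ∧ (∀ ω, N ω < N' ω) ∧
      ∀ ω, (∃ᶠ n in atTop, q ω n) → q ω (N' ω) := by
  classical
  let p : Ω → ℕ → Prop := fun ω n => N ω < n ∧ (q ω n ∨ ∀ j, N ω < j → ¬ q ω j)
  have hp : ∀ ω, ∃ n, p ω n := fun ω => by
    by_cases h : ∃ j, N ω < j ∧ q ω j
    · obtain ⟨j, hj, hqj⟩ := h
      exact ⟨j, hj, Or.inl hqj⟩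
    · push Not at h
      exact ⟨N ω + 1, Nat.lt_succ_self _, Or.inr h⟩
  have hlt : ∀ j, MeasurableSet {ω | N ω < j} := fun j => measurableSet_lt hN measurable_const
  refine ⟨fun ω => Nat.find (hp ω), measurable_find hp fun n => ?_,
    fun ω => (Nat.find_spec (hp ω)).1, fun ω hω => ?_⟩
  · refine (hlt n).inter ((hq n).union ?_)
    have : {ω | ∀ j, N ω < j → ¬ q ω j} = ⋂ j, ({ω | N ω < j}ᶜ ∪ {ω | q ω j}ᶜ) := by
      ext ω
      simp only [Set.mem_ofPred_eq, Set.mem_iInter, Set.mem_union, Set.mem_compl_iff,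
        imp_iff_not_or]
    change MeasurableSet {ω | ∀ j, N ω < j → ¬ q ω j}
    rw [this]
    exact MeasurableSet.iInter fun j => (hlt j).compl.union (hq j).compl
  · obtain ⟨j, hj, hqj⟩ := (frequently_atTop.1 hω) (N ω + 1)
    exact (Nat.find_spec (hp ω)).2.resolve_right fun h => h j hj hqj

/-- A sequence of measurable real functions has a measurable random subsequence converging
to a measurable limit at every outcome where the sequence is bounded. -/
theorem exists_measurable_random_subsequence {Ω : Type*} [MeasurableSpace Ω] {y : ℕ → Ω → ℝ}
    (hy : ∀ n, Measurable (y n)) :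
    ∃ (σ : ℕ → Ω → ℕ) (l : Ω → ℝ), (∀ k, Measurable (σ k)) ∧ (∀ ω, StrictMono fun k => σ k ω) ∧
      Measurable l ∧
      ∀ ω, (∃ C : ℝ, ∀ n, |y n ω| ≤ C) → Tendsto (fun k => y (σ k ω) ω) atTop (𝓝 (l ω)) := by
  let l : Ω → ℝ := fun ω => limsup (fun n => y n ω) atTop
  have hl : Measurable l := Measurable.limsup hy
  have hq : ∀ k n : ℕ, MeasurableSet {ω | dist (y n ω) (l ω) < 1 / ((k : ℝ) + 1)} := fun k n =>
    measurableSet_lt ((hy n).dist hl) measurable_const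
  choose next hnext_meas hnext_lt hnext using fun (k : ℕ) (N : {N : Ω → ℕ // Measurable N}) =>
    exists_measurable_next_index (hq k) N.2
  let σ : ℕ → {N : Ω → ℕ // Measurable N} := fun k =>
    k.rec ⟨fun _ => 0, measurable_const⟩ fun k N => ⟨next k N, hnext_meas k N⟩
  refine ⟨fun k => σ (k + 1), l, fun k => (σ (k + 1)).2,
    fun ω => strictMono_nat_of_lt_succ fun k => hnext_lt (k + 1) (σ (k + 1)) ω, hl, ?_⟩
  rintro ω ⟨C, hC⟩
  have hba : IsBoundedUnder (· ≤ ·) atTop fun n => y n ω :=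
    isBoundedUnder_of ⟨C, fun n => (abs_le.1 (hC n)).2⟩
  have hbb : IsBoundedUnder (· ≥ ·) atTop fun n => y n ω :=
    isBoundedUnder_of ⟨-C, fun n => (abs_le.1 (hC n)).1⟩
  have hfreq : ∀ ε > 0, ∃ᶠ n in atTop, dist (y n ω) (l ω) < ε := fun ε hε => by
    have h₁ : ∃ᶠ n in atTop, l ω - ε < y n ω :=
      frequently_lt_of_lt_limsup hbb.isCoboundedUnder_le (sub_lt_self _ hε)
    have h₂ : ∀ᶠ n in atTop, y n ω < l ω + ε :=
      eventually_lt_of_limsup_lt (lt_add_of_pos_right _ hε) hba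
    refine (h₁.and_eventually h₂).mono fun n hn => ?_
    rw [Real.dist_eq, abs_lt]
    constructor <;> linarith [hn.1, hn.2]
  refine tendsto_iff_dist_tendsto_zero.2 (squeeze_zero (fun _ => dist_nonneg)
    (fun k => ?_) tendsto_one_div_add_atTop_nhds_zero_nat)
  exact (hnext k (σ k) ω (hfreq _ Nat.one_div_pos_of_nat)).le

/-- Over a finite linearly ordered set of coordinates, each measurable with respect to a σ-algebra
increasing with the coordinate, a random subsequence can be chosen so that the limit of every
coordinate is measurable with respect to the σ-algebra of that coordinate. -/
theorem exists_random_subsequence_of_monotone {Ω ι : Type*} [LinearOrder ι]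
    {m : ι → MeasurableSpace Ω} (hm : Monotone m) {y : ℕ → Ω → ι → ℝ}
    (hy : ∀ n i, Measurable[m i] fun ω => y n ω i) (s : Finset ι) :
    ∃ (τ : ℕ → Ω → ℕ) (l : Ω → ι → ℝ),
      (∀ k, Measurable[⨆ i ∈ s, m i] (τ k)) ∧ (∀ ω, StrictMono fun k => τ k ω) ∧
      (∀ i, Measurable[m i] fun ω => l ω i) ∧
      ∀ ω, (∃ C : ℝ, ∀ n i, |y n ω i| ≤ C) →
        ∀ i ∈ s, Tendsto (fun k => y (τ k ω) ω i) atTop (𝓝 (l ω i)) := by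
  induction s using Finset.induction_on_max with
  | empty =>
    exact ⟨fun k _ => k, fun _ _ => 0, fun _ => measurable_const, fun _ => strictMono_id,
      fun _ => measurable_const, by simp⟩
  | insert a s hs ih =>
    obtain ⟨τ, l, hτ, hτ_mono, hl, hlim⟩ := ih
    have hsa : ⨆ i ∈ s, m i ≤ m a := iSup₂_le fun i hi => hm (hs i hi).le
    have has : m a ≤ ⨆ i ∈ insert a s, m i :=
      le_iSup₂ (f := fun i (_ : i ∈ insert a s) => m i) a (Finset.mem_insert_self a s)
    have hτa : ∀ k, Measurable[m a] (τ k) := fun k => (hτ k).mono hsa le_rfl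
    obtain ⟨σ, z, hσ, hσ_mono, hz, hzlim⟩ :=
      @exists_measurable_random_subsequence Ω (m a) (fun k ω => y (τ k ω) ω a) fun k =>
        @measurable_random_index Ω ℝ (m a) _ (fun n ω => y n ω a) _ (fun n => hy n a) (hτa k)
    refine ⟨fun k ω => τ (σ k ω) ω, fun ω => Function.update (l ω) a (z ω), fun k => ?_,
      fun ω => (hτ_mono ω).comp (hσ_mono ω), fun i => ?_, fun ω hω i hi => ?_⟩
    · exact (@measurable_random_index Ω ℕ (m a) _ τ _ hτa (hσ k)).mono has le_rfl
    · rcases eq_or_ne i a with rfl | hia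
      · simpa using hz
      · simpa [hia] using hl i
    · rcases eq_or_ne i a with rfl | hia
      · simpa using hzlim ω (hω.imp fun C hC n => hC _ i)
      · simpa [hia, Function.comp_def] using (hlim ω hω i (Finset.mem_of_mem_insert_of_ne hi hia)).comp
          (hσ_mono ω).tendsto_atTop

/-- An almost surely bounded sequence of adapted processes admits an `ℱ_T`-measurable
(random) subsequence converging almost surely to an adapted process. -/
theorem random_subsequence {Ω : Type*} [mΩ : MeasurableSpace Ω] (P : Measure Ω)
    [IsProbabilityMeasure P]
    (T : ℕ) (ℱ : Filtration (Fin (T + 1)) mΩ) (n : Fin (T + 1) → ℕ)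
    (x : ℕ → Ω → ∀ t, Fin (n t) → ℝ)
    (hadapted : ∀ ν t, Measurable[ℱ t] fun ω => x ν ω t)
    (hbdd : ∀ᵐ ω ∂P, ∃ C : ℝ, ∀ ν, ‖x ν ω‖ ≤ C) :
    ∃ (τ : ℕ → Ω → ℕ) (xlim : Ω → ∀ t, Fin (n t) → ℝ),
      (∀ ν, Measurable[ℱ (Fin.last T)] (τ ν)) ∧
      (∀ ν ω, τ ν ω < τ (ν + 1) ω) ∧
      (∀ t, Measurable[ℱ t] fun ω => xlim ω t) ∧
      ∀ᵐ ω ∂P, Tendsto (fun ν => x (τ ν ω) ω) atTop (nhds (xlim ω)) := by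
  have hm : Monotone fun i : Σₗ t, Fin (n t) => ℱ (ofLex i).1 := fun i j hij =>
    ℱ.mono (by
      rcases Sigma.Lex.le_def.1 hij with h | ⟨h, -⟩
      · exact h.le
      · exact h.le)
  obtain ⟨τ, l, hτ, hτ_mono, hl, hlim⟩ := exists_random_subsequence_of_monotone hm
    (y := fun ν ω i => x ν ω (ofLex i).1 (ofLex i).2)
    (fun ν i => (measurable_pi_apply _).comp (hadapted ν _)) Finset.univ
  refine ⟨τ, fun ω t j => l ω (toLex ⟨t, j⟩), fun ν => (hτ ν).mono ?_ le_rfl,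
    fun ν ω => hτ_mono ω ν.lt_succ_self,
    fun t => @measurable_pi_lambda _ _ _ (ℱ t) _ _ fun j => hl (toLex ⟨t, j⟩), ?_⟩
  · exact iSup₂_le fun i _ => ℱ.mono (Fin.le_last _)
  · filter_upwards [hbdd] with ω ⟨C, hC⟩
    refine tendsto_pi_nhds.2 fun t => tendsto_pi_nhds.2 fun j =>
      hlim ω ⟨C, fun ν i => ?_⟩ (toLex ⟨t, j⟩) (Finset.mem_univ _)
    exact ((norm_le_pi_norm (x ν ω (ofLex i).1) _).trans (norm_le_pi_norm (x ν ω) _)).trans (hC ν)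
end

section
/- Let (Ω,ℱ,P) be a probability space with a filtration (ℱ_t)_{t=0}^T, 𝒩 the space of adapted processes x=(x_t)_{t=0}^T with x_t ∈ L^0(Ω,ℱ_t,P;ℝ^{n_t}), and n = n_0+…+n_T. Let C : Ω ⇉ ℝ^n be a set-valued mapping with nonempty closed convex values whose graph {(ω,x) : x ∈ C(ω)} is ℱ⊗Borel(ℝ^n)-measurable, and define C^∞(ω) := {z ∈ ℝ^n : x + αz ∈ C(ω) for all x ∈ C(ω) and all α > 0}. Assume 𝒞 := {x ∈ 𝒩 : x(ω) ∈ C(ω) P-a.s.} is nonempty. Then every sequence in 𝒞 is almost surely bounded (i.e. for every sequence (x^ν) ⊂ 𝒞, sup_ν |x^ν(ω)| < ∞ P-a.s.) if and only if {x ∈ 𝒩 : x(ω) ∈ C^∞(ω) P-a.s.} = {0}. -/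
open MeasureTheory Filter Topology

/-- The recession cone of a set `K` in a real vector space. -/
def recessionCone {E : Type*} [AddCommMonoid E] [SMul ℝ E] (K : Set E) : Set E :=
  {z | ∀ v ∈ K, ∀ α : ℝ, 0 < α → v + α • z ∈ K}

/-- Measurable selection of an index `τ k ω ≥ k` satisfying a measurable predicate whenever
such an index exists. -/
theorem exists_measurable_index {Ω : Type*} {m : MeasurableSpace Ω} (p : ℕ → ℕ → Ω → Prop)
    (hp : ∀ k ν, MeasurableSet {ω | p k ν ω}) :
    ∃ τ : ℕ → Ω → ℕ, (∀ k, Measurable (τ k)) ∧ (∀ k ω, k ≤ τ k ω) ∧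
      ∀ k ω, (∃ ν, k ≤ ν ∧ p k ν ω) → p k (τ k ω) ω := by
  classical
  let q : ℕ → Ω → ℕ → Prop := fun k ω ν => k ≤ ν ∧ (p k ν ω ∨ ¬ ∃ ν, k ≤ ν ∧ p k ν ω)
  have hq : ∀ k ω, ∃ ν, q k ω ν := by
    intro k ω
    by_cases h : ∃ ν, k ≤ ν ∧ p k ν ω
    · obtain ⟨ν, h1, h2⟩ := h
      exact ⟨ν, h1, Or.inl h2⟩
    · exact ⟨k, le_rfl, Or.inr h⟩
  refine ⟨fun k ω => Nat.find (hq k ω), fun k => ?_, fun k ω => (Nat.find_spec (hq k ω)).1,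
    fun k ω h => (Nat.find_spec (hq k ω)).2.resolve_right (not_not_intro h)⟩
  refine measurable_find _ fun ν => ?_
  have hex : MeasurableSet {ω | ∃ ν, k ≤ ν ∧ p k ν ω} := by
    simp only [Set.ofPred_exists]
    exact MeasurableSet.iUnion fun ν => (MeasurableSet.const _).inter (hp k ν)
  exact (MeasurableSet.const _).inter ((hp k ν).union hex.compl)

theorem measurable_comp_index {Ω : Type*} {m : MeasurableSpace Ω} {f : ℕ → Ω → ℝ}
    (hf : ∀ k, Measurable (f k)) {τ : Ω → ℕ} (hτ : Measurable τ) :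
    Measurable fun ω => f (τ ω) ω :=
  (measurable_from_prod_countable_right (f := fun q : ℕ × Ω => f q.1 q.2) hf).comp
    (hτ.prodMk measurable_id)

theorem exists_ge_abs_sub_liminf_lt {a : ℕ → ℝ} {M : ℝ} (hM : ∀ k, |a k| ≤ M) {ε : ℝ}
    (hε : 0 < ε) (k : ℕ) : ∃ ν, k ≤ ν ∧ |a ν - liminf a atTop| < ε := by
  have hge : IsBoundedUnder (· ≥ ·) atTop a :=
    isBoundedUnder_of ⟨-M, fun k => (abs_le.1 (hM k)).1⟩
  have hle : IsBoundedUnder (· ≤ ·) atTop a :=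
    isBoundedUnder_of ⟨M, fun k => (abs_le.1 (hM k)).2⟩
  have h1 : ∃ᶠ ν in atTop, a ν < liminf a atTop + ε :=
    frequently_lt_of_liminf_lt hle.isCoboundedUnder_ge (by linarith)
  have h2 : ∀ᶠ ν in atTop, liminf a atTop - ε < a ν :=
    eventually_lt_of_lt_liminf (by linarith) hge
  obtain ⟨ν, hν, h3, h4⟩ := frequently_atTop.1 (h1.and_eventually h2) k
  exact ⟨ν, hν, abs_lt.2 ⟨by linarith, by linarith⟩⟩

/-- Limits of `λ • c` with `c` in a closed convex set and `λ → 0` are recession directions. -/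
theorem mem_recessionCone_of_tendsto {E : Type*} [AddCommGroup E] [Module ℝ E]
    [TopologicalSpace E] [ContinuousAdd E] [ContinuousSMul ℝ E] {K : Set E}
    (hcl : IsClosed K) (hcv : Convex ℝ K) {l : ℕ → ℝ} {u : ℕ → E} {z : E}
    (hl : ∀ k, 0 ≤ l k) (hu : ∀ k, ∃ c ∈ K, u k = l k • c)
    (hl0 : Tendsto l atTop (𝓝 0)) (huz : Tendsto u atTop (𝓝 z)) : z ∈ recessionCone K := by
  intro v hv α hα
  have hlim : Tendsto (fun k => (1 - α * l k) • v + α • u k) atTop (𝓝 (v + α • z)) := by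
    have := (((hl0.const_mul α).const_sub 1).smul_const v).add (huz.const_smul α)
    simpa using this
  refine hcl.mem_of_tendsto hlim ?_
  have hev : ∀ᶠ k in atTop, α * l k < 1 :=
    (by simpa using hl0.const_mul α : Tendsto (fun k => α * l k) atTop (𝓝 0)).eventually_lt_const
      one_pos
  filter_upwards [hev] with k hk
  obtain ⟨c, hc, hcu⟩ := hu k
  rw [hcu, smul_smul]
  exact hcv hv hc (by linarith) (mul_nonneg hα.le (hl k)) (by ring)

theorem measurableSet_not_bounded {Ω : Type*} {m : MeasurableSpace Ω} {f : ℕ → Ω → ℝ}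
    (hf : ∀ k, Measurable (f k)) :
    MeasurableSet {ω | ¬ ∃ M, ∀ k, |f k ω| ≤ M} := by
  have : {ω | ¬ ∃ M, ∀ k, |f k ω| ≤ M} = (⋃ M : ℕ, ⋂ k, {ω | |f k ω| ≤ M})ᶜ := by
    ext ω
    simp only [Set.mem_ofPred_eq, Set.mem_compl_iff, Set.mem_iUnion, Set.mem_iInter]
    refine not_congr ⟨fun ⟨M, hM⟩ => ?_, fun ⟨M, hM⟩ => ⟨M, hM⟩⟩
    obtain ⟨n, hn⟩ := exists_nat_ge M
    exact ⟨n, fun k => (hM k).trans hn⟩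
  rw [this]
  exact (MeasurableSet.iUnion fun M => MeasurableSet.iInter fun k =>
    measurableSet_le (hf k).abs measurable_const).compl

theorem exists_ge_lt_abs_of_not_bounded {a : ℕ → ℝ} (ha : ¬ ∃ M, ∀ k, |a k| ≤ M) (k : ℕ)
    (c : ℝ) : ∃ ν, k ≤ ν ∧ c < |a ν| := by
  by_contra! h
  refine ha ⟨max c (∑ ν ∈ Finset.range k, |a ν|), fun ν => ?_⟩
  rcases le_or_gt k ν with hk | hk
  · exact (h ν hk).trans (le_max_left _ _)
  · exact (Finset.single_le_sum (f := fun ν => |a ν|) (fun _ _ => abs_nonneg _)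
      (Finset.mem_range.2 hk)).trans (le_max_right _ _)

section Adapted

variable {Ω : Type*} [mΩ : MeasurableSpace Ω] {P : Measure Ω} {N : ℕ}
  {𝒢 : Fin N → MeasurableSpace Ω}

/-- An almost surely bounded sequence, whose first `j` coordinates converge to adapted limits and
whose other coordinates are adapted, has an adapted process as almost sure cluster point. -/
theorem exists_adapted_cluster_point (h𝒢 : Monotone 𝒢) (j : ℕ) (hj : j ≤ N)
    (u : ℕ → Ω → Fin N → ℝ) (y : Ω → Fin N → ℝ)
    (hum : ∀ k, ∀ s : Fin N, j ≤ s → Measurable[𝒢 s] fun ω => u k ω s)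
    (hym : ∀ s : Fin N, s < j → Measurable[𝒢 s] fun ω => y ω s)
    (huy : ∀ᵐ ω ∂P, ∀ s : Fin N, s < j → Tendsto (fun k => u k ω s) atTop (𝓝 (y ω s)))
    (hub : ∀ᵐ ω ∂P, ∀ s, ∃ M, ∀ k, |u k ω s| ≤ M) :
    ∃ z : Ω → Fin N → ℝ, (∀ s, Measurable[𝒢 s] fun ω => z ω s) ∧
      ∀ᵐ ω ∂P, ∃ σ : ℕ → ℕ, Tendsto σ atTop atTop ∧
        Tendsto (fun k => u (σ k) ω) atTop (𝓝 (z ω)) := by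
  induction hj using Nat.decreasingInduction generalizing u y with
  | self =>
    refine ⟨y, fun s => hym s s.2, ?_⟩
    filter_upwards [huy] with ω hω
    exact ⟨id, tendsto_id, tendsto_pi_nhds.2 fun s => hω s s.2⟩
  | of_succ j hj ih =>
    let i : Fin N := ⟨j, hj⟩
    let l : Ω → ℝ := fun ω => liminf (fun k => u k ω i) atTop
    have hlm : Measurable[𝒢 i] l := Measurable.liminf fun k => hum k i le_rfl
    obtain ⟨τ, hτm, hτ, hτp⟩ := exists_measurable_index (m := 𝒢 i)
      (fun k ν ω => |u ν ω i - l ω| < 1 / ((k : ℝ) + 1)) (fun k ν =>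
        measurableSet_lt (measurable_abs.comp ((hum ν i le_rfl).sub hlm)) measurable_const)
    have hτt : ∀ ω, Tendsto (fun k => τ k ω) atTop atTop := fun ω =>
      tendsto_atTop_mono (fun k => hτ k ω) tendsto_id
    obtain ⟨z, hzm, hz⟩ := ih (fun k ω => u (τ k ω) ω) (fun ω => Function.update (y ω) i (l ω))
      (fun k s hs => by
        have his : i ≤ s := Fin.le_def.2 (by simp only [i]; omega)
        exact measurable_comp_index (m := 𝒢 s) (fun k => hum k s (by omega))
          ((hτm k).mono (h𝒢 his) le_rfl))
      (fun s hs => by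
        rcases eq_or_ne s i with rfl | hne
        · simpa using hlm
        · have : (s : ℕ) ≠ j := fun h => hne (Fin.ext h)
          simpa [hne] using hym s (by omega))
      (by
        filter_upwards [huy, hub] with ω hω hbω s hs
        rcases eq_or_ne s i with rfl | hne
        · simp only [Function.update_self]
          obtain ⟨M, hM⟩ := hbω i
          rw [tendsto_iff_dist_tendsto_zero]
          refine squeeze_zero (fun _ => dist_nonneg) (fun k => ?_)
            tendsto_one_div_add_atTop_nhds_zero_nat
          exact (hτp k ω (exists_ge_abs_sub_liminf_lt hM (by positivity) k)).le
        · have : (s : ℕ) ≠ j := fun h => hne (Fin.ext h)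
          simpa [hne, Function.comp_def] using (hω s (by omega)).comp (hτt ω))
      (by
        filter_upwards [hub] with ω hω s
        obtain ⟨M, hM⟩ := hω s
        exact ⟨M, fun k => hM _⟩)
    refine ⟨z, hzm, ?_⟩
    filter_upwards [hz] with ω ⟨σ, hσ, hσz⟩
    exact ⟨fun k => τ (σ k) ω, (hτt ω).comp hσ, hσz⟩

/-- If zero is the only adapted selection of the recession cones, then a sequence in bounded
nonnegative multiples of `C`, whose first `j` coordinates are bounded and whose other coordinates
are adapted, is almost surely bounded. -/
theorem ae_bounded_of_recessionCone_trivial (h𝒢 : Monotone 𝒢) (C : Ω → Set (Fin N → ℝ))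
    (hcl : ∀ ω, IsClosed (C ω)) (hcv : ∀ ω, Convex ℝ (C ω))
    (htriv : ∀ z : Ω → Fin N → ℝ, (∀ s, Measurable[𝒢 s] fun ω => z ω s) →
      (∀ᵐ ω ∂P, z ω ∈ recessionCone (C ω)) → ∀ᵐ ω ∂P, z ω = 0)
    (j : ℕ) (hj : j ≤ N) (v : ℕ → Ω → Fin N → ℝ) (l : ℕ → Ω → ℝ)
    (hvm : ∀ k, ∀ s : Fin N, j ≤ s → Measurable[𝒢 s] fun ω => v k ω s)
    (hl : ∀ᵐ ω ∂P, ∀ k, 0 ≤ l k ω) (hvl : ∀ᵐ ω ∂P, ∀ k, ∃ c ∈ C ω, v k ω = l k ω • c)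
    (hlb : ∀ᵐ ω ∂P, ∃ M, ∀ k, l k ω ≤ M)
    (hvb : ∀ᵐ ω ∂P, ∀ s : Fin N, s < j → ∃ M, ∀ k, |v k ω s| ≤ M) :
    ∀ᵐ ω ∂P, ∀ s, ∃ M, ∀ k, |v k ω s| ≤ M := by
  induction hj using Nat.decreasingInduction generalizing v l with
  | self => filter_upwards [hvb] with ω hω s using hω s s.2
  | of_succ j hj ih =>
    let i : Fin N := ⟨j, hj⟩
    have hlt : ∀ s : Fin N, (s : ℕ) < j + 1 → s ≠ i → (s : ℕ) < j := fun s hs hsi =>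
      lt_of_le_of_ne (by omega) fun h => hsi (Fin.ext h)
    suffices hvi : ∀ᵐ ω ∂P, ∃ M, ∀ k, |v k ω i| ≤ M by
      refine ih v l (fun k s hs => hvm k s (by omega)) hl hvl hlb ?_
      filter_upwards [hvb, hvi] with ω hω hωi s hs
      rcases eq_or_ne s i with rfl | hsi
      · exact hωi
      · exact hω s (hlt s hs hsi)
    let B : Set Ω := {ω | ¬ ∃ M, ∀ k, |v k ω i| ≤ M}
    have hB : MeasurableSet[𝒢 i] B := measurableSet_not_bounded fun k => hvm k i le_rfl
    obtain ⟨τ, hτm, -, hτp⟩ := exists_measurable_index (m := 𝒢 i)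
      (fun k ν ω => (k : ℝ) + 1 < |v ν ω i|) (fun k ν =>
        measurableSet_lt measurable_const (measurable_abs.comp (hvm ν i le_rfl)))
    have hτB : ∀ ω ∈ B, ∀ k : ℕ, (k : ℝ) + 1 < |v (τ k ω) ω i| := fun ω hω k =>
      hτp k ω (exists_ge_lt_abs_of_not_bounded hω k _)
    let r : ℕ → Ω → ℝ := fun k => B.indicator fun ω => |v (τ k ω) ω i|⁻¹
    have hrm : ∀ k, Measurable[𝒢 i] (r k) := fun k =>
      (measurable_inv.comp (measurable_abs.comp (measurable_comp_index (m := 𝒢 i)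
        (fun k => hvm k i le_rfl) (hτm k)))).indicator hB
    have hr0 : ∀ k ω, 0 ≤ r k ω := fun k ω =>
      Set.indicator_nonneg (fun _ _ => inv_nonneg.2 (abs_nonneg _)) ω
    have hr1 : ∀ k ω, r k ω ≤ 1 / ((k : ℝ) + 1) := by
      intro k ω
      by_cases hω : ω ∈ B
      · simp only [r, Set.indicator_of_mem hω, one_div]
        exact inv_anti₀ (by positivity) (hτB ω hω k).le
      · simp only [r, Set.indicator_of_notMem hω]
        positivity
    have hlim : ∀ ω (a : ℕ → ℝ), (∃ M, ∀ k, |a k| ≤ M) →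
        Tendsto (fun k => r k ω * a (τ k ω)) atTop (𝓝 0) := by
      rintro ω a ⟨M, hM⟩
      refine squeeze_zero_norm (fun k => ?_)
        (by simpa only [zero_mul] using tendsto_one_div_add_atTop_nhds_zero_nat.mul_const M)
      rw [norm_mul, Real.norm_of_nonneg (hr0 k ω)]
      exact mul_le_mul (hr1 k ω) (hM _) (abs_nonneg _) (by positivity)
    let u : ℕ → Ω → Fin N → ℝ := fun k ω => r k ω • v (τ k ω) ω
    have hui : ∀ ω ∈ B, ∀ k, |u k ω i| = 1 := by
      intro ω hω k
      have hpos : 0 < |v (τ k ω) ω i| := lt_trans (by positivity) (hτB ω hω k)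
      simp only [u, r, Set.indicator_of_mem hω, Pi.smul_apply, smul_eq_mul, abs_mul, abs_inv,
        abs_abs]
      exact inv_mul_cancel₀ hpos.ne'
    have hum : ∀ k, ∀ s : Fin N, j ≤ s → Measurable[𝒢 s] fun ω => u k ω s := by
      intro k s hs
      have his : 𝒢 i ≤ 𝒢 s := h𝒢 (Fin.le_def.2 hs)
      exact ((hrm k).mono his le_rfl).mul (measurable_comp_index (m := 𝒢 s)
        (fun k => hvm k s hs) ((hτm k).mono his le_rfl))
    have hmul0 : ∀ᵐ ω ∂P, ∀ k, 0 ≤ r k ω * l (τ k ω) ω := by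
      filter_upwards [hl] with ω hω k using mul_nonneg (hr0 k ω) (hω _)
    have humul : ∀ᵐ ω ∂P, ∀ k, ∃ c ∈ C ω, u k ω = (r k ω * l (τ k ω) ω) • c := by
      filter_upwards [hvl] with ω hω k
      obtain ⟨c, hc, hcv⟩ := hω (τ k ω)
      exact ⟨c, hc, by simp only [u, hcv, smul_smul]⟩
    have hmulz : ∀ᵐ ω ∂P, Tendsto (fun k => r k ω * l (τ k ω) ω) atTop (𝓝 0) := by
      filter_upwards [hl, hlb] with ω hω ⟨M, hM⟩
      exact hlim ω (fun k => l k ω) ⟨M, fun k => by rw [abs_of_nonneg (hω k)]; exact hM k⟩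
    have huz : ∀ᵐ ω ∂P, ∀ s : Fin N, s < j → Tendsto (fun k => u k ω s) atTop (𝓝 0) := by
      filter_upwards [hvb] with ω hω s hs using hlim ω (fun k => v k ω s) (hω s hs)
    have hub : ∀ᵐ ω ∂P, ∀ s, ∃ M, ∀ k, |u k ω s| ≤ M := by
      refine ih u (fun k ω => r k ω * l (τ k ω) ω) (fun k s hs => hum k s (by omega)) hmul0 humul
        ?_ ?_
      · filter_upwards [hmulz] with ω hω
        obtain ⟨M, hM⟩ := hω.bddAbove_range
        exact ⟨M, fun k => hM ⟨k, rfl⟩⟩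
      · filter_upwards [huz] with ω hω s hs
        rcases eq_or_ne s i with rfl | hsi
        · refine ⟨1, fun k => ?_⟩
          by_cases hωB : ω ∈ B
          · exact (hui ω hωB k).le
          · simp [u, r, Set.indicator_of_notMem hωB]
        · obtain ⟨M, hM⟩ := (hω s (hlt s hs hsi)).abs.bddAbove_range
          exact ⟨M, fun k => hM ⟨k, rfl⟩⟩
    obtain ⟨z, hzm, hz⟩ := exists_adapted_cluster_point h𝒢 j hj.le u 0 hum
      (fun s _ => measurable_const) huz hub
    have hz0 : ∀ᵐ ω ∂P, z ω = 0 := by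
      refine htriv z hzm ?_
      filter_upwards [hz, hmul0, humul, hmulz] with ω ⟨σ, hσ, hσz⟩ h0 hc hlz
      exact mem_recessionCone_of_tendsto (hcl ω) (hcv ω) (fun k => h0 (σ k)) (fun k => hc (σ k))
        (hlz.comp hσ) hσz
    filter_upwards [hz, hz0] with ω ⟨σ, _, hσz⟩ hω0
    by_contra hωB
    have h1 := (tendsto_pi_nhds.1 hσz i).abs
    simp only [hui ω hωB, hω0, Pi.zero_apply, abs_zero] at h1
    exact one_ne_zero (tendsto_nhds_unique tendsto_const_nhds h1)

end Adapted

/-- Every sequence of adapted selections of a closed convex-valued measurable mapping `C`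
is almost surely bounded if and only if the only adapted selection of the recession cone
mapping `C^∞` is the zero process. -/
theorem as_bounded_iff_recession_trivial {Ω : Type*} [mΩ : MeasurableSpace Ω] (P : Measure Ω)
    [IsProbabilityMeasure P]
    (T : ℕ) (ℱ : Filtration (Fin (T + 1)) mΩ) (n : Fin (T + 1) → ℕ)
    (C : Ω → Set (∀ t, Fin (n t) → ℝ))
    (hCne : ∀ ω, (C ω).Nonempty)
    (hCclosed : ∀ ω, IsClosed (C ω))
    (hCconvex : ∀ ω, Convex ℝ (C ω))
    (hCgraph : MeasurableSet {r : Ω × (∀ t, Fin (n t) → ℝ) | r.2 ∈ C r.1})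
    (hfeas : ∃ x : Ω → ∀ t, Fin (n t) → ℝ,
      (∀ t, Measurable[ℱ t] fun ω => x ω t) ∧ ∀ᵐ ω ∂P, x ω ∈ C ω) :
    (∀ x : ℕ → Ω → ∀ t, Fin (n t) → ℝ,
        (∀ ν t, Measurable[ℱ t] fun ω => x ν ω t) →
        (∀ ν, ∀ᵐ ω ∂P, x ν ω ∈ C ω) →
        ∀ᵐ ω ∂P, ∃ M : ℝ, ∀ ν, ‖x ν ω‖ ≤ M)
      ↔ (∀ x : Ω → ∀ t, Fin (n t) → ℝ,
          (∀ t, Measurable[ℱ t] fun ω => x ω t) →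
          (∀ᵐ ω ∂P, x ω ∈ recessionCone (C ω)) →
          ∀ᵐ ω ∂P, x ω = 0) := by
  refine ⟨fun hb z hzm hz => ?_, fun htriv x hxm hx => ?_⟩
  · obtain ⟨y, hym, hy⟩ := hfeas
    have hbd := hb (fun ν ω => y ω + ((ν : ℝ) + 1) • z ω)
      (fun ν t => (hym t).add ((hzm t).const_smul ((ν : ℝ) + 1)))
      (fun ν => by
        filter_upwards [hy, hz] with ω hyω hzω using hzω _ hyω _ (by positivity))
    filter_upwards [hbd] with ω ⟨M, hM⟩
    by_contra hne
    have hpos : 0 < ‖z ω‖ := norm_pos_iff.2 hne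
    obtain ⟨ν, hν⟩ := exists_nat_gt ((M + ‖y ω‖) / ‖z ω‖)
    rw [div_lt_iff₀ hpos] at hν
    have h1 := norm_sub_le (y ω + ((ν : ℝ) + 1) • z ω) (y ω)
    rw [add_sub_cancel_left, norm_smul, Real.norm_of_nonneg (by positivity)] at h1
    have h2 := hM ν
    nlinarith
  · let ι := Σₗ t, Fin (n t)
    let e : Fin (Fintype.card ι) ≃o ι := Fintype.orderIsoFinOfCardEq ι rfl
    let Φ : (Fin (Fintype.card ι) → ℝ) →ₗ[ℝ] (∀ t, Fin (n t) → ℝ) :=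
      { toFun := fun y t i => y (e.symm (toLex ⟨t, i⟩))
        map_add' := fun _ _ => rfl
        map_smul' := fun _ _ => rfl }
    let Ψ : (∀ t, Fin (n t) → ℝ) → (Fin (Fintype.card ι) → ℝ) :=
      fun w s => w (ofLex (e s)).1 (ofLex (e s)).2
    have hΦΨ : ∀ w, Φ (Ψ w) = w := by
      intro w
      funext t i
      have h := e.apply_symm_apply (toLex ⟨t, i⟩)
      simp only [Φ, Ψ, LinearMap.coe_mk, AddHom.coe_mk]
      rw [h]
      rfl
    have hΨΦ : ∀ y, Ψ (Φ y) = y := by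
      intro y
      funext s
      simp [Φ, Ψ]
    have hΦc : Continuous Φ := by
      refine continuous_pi fun t => continuous_pi fun i => continuous_apply _
    have hmono : Monotone fun s => ℱ (ofLex (e s)).1 := by
      intro s s' h
      refine ℱ.mono ?_
      have h' := e.monotone h
      rcases Sigma.Lex.le_def.1 h' with h' | ⟨h', _⟩
      · exact h'.le
      · exact h'.le
    have key := ae_bounded_of_recessionCone_trivial (P := P) hmono (fun ω => Φ ⁻¹' C ω)
      (fun ω => (hCclosed ω).preimage hΦc) (fun ω => (hCconvex ω).linear_preimage Φ)
      (fun z hzm hz => by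
        have h := htriv (fun ω => Φ (z ω)) (fun t =>
            @measurable_pi_lambda Ω (Fin (n t)) _ (ℱ t) _ _ fun i => by
              have h := hzm (e.symm (toLex ⟨t, i⟩))
              rw [e.apply_symm_apply] at h
              exact h) (by
          filter_upwards [hz] with ω hω w hw α hα
          have := hω (Ψ w) (by simpa [hΦΨ] using hw) α hα
          simpa [hΦΨ] using this)
        filter_upwards [h] with ω hω
        rw [← hΨΦ (z ω), hω]
        rfl)
      0 (Nat.zero_le _) (fun ν ω => Ψ (x ν ω)) (fun _ _ => 1)
      (fun ν s _ => (measurable_pi_apply _).comp (hxm ν _))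
      (Eventually.of_forall fun _ _ => zero_le_one)
      (by
        filter_upwards [ae_all_iff.2 hx] with ω hω ν
        exact ⟨Ψ (x ν ω), by simpa [hΦΨ] using hω ν, (one_smul _ _).symm⟩)
      (Eventually.of_forall fun _ => ⟨1, fun _ => le_rfl⟩)
      (Eventually.of_forall fun _ _ h => absurd h (Nat.not_lt_zero _))
    filter_upwards [key] with ω hω
    choose M hM using hω
    have hM0 : ∀ s, 0 ≤ M s := fun s => (abs_nonneg _).trans (hM s 0)
    refine ⟨∑ s, M s, fun ν => ?_⟩
    have hS : 0 ≤ ∑ s, M s := Finset.sum_nonneg fun s _ => hM0 s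
    refine (pi_norm_le_iff_of_nonneg hS).2 fun t => (pi_norm_le_iff_of_nonneg hS).2 fun i => ?_
    have h := (hM (e.symm (toLex ⟨t, i⟩)) ν).trans
      (Finset.single_le_sum (fun s _ => hM0 s) (Finset.mem_univ _))
    rwa [← hΦΨ (x ν ω)]
end

section
/- Let (Ω,ℱ,P) be a probability space with a filtration (ℱ_t)_{t=0}^T, 𝒩 the space of adapted processes x=(x_t)_{t=0}^T with x_t ∈ L^0(Ω,ℱ_t,P;ℝ^{n_t}), and n = n_0+…+n_T. Let L : Ω ⇉ ℝ^n be a set-valued mapping whose values are linear subspaces of ℝ^n and whose graph is ℱ⊗Borel(ℝ^n)-measurable. Then for each t = 0,…,T there exists a set-valued mapping L_t : Ω ⇉ ℝ^{n_t} whose values are linear subspaces and whose graph is ℱ_t⊗Borel(ℝ^{n_t})-measurable, such that for every x_t ∈ L^0(Ω,ℱ_t,P;ℝ^{n_t}): there exists z ∈ 𝒩 with (0,…,0,x_t,z_{t+1},…,z_T)(ω) ∈ L(ω) P-a.s. if and only if x_t(ω) ∈ L_t(ω) P-a.s. -/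
open MeasureTheory Filter Topology

section StableModule

variable {Ω ι : Type*} {m mΩ : MeasurableSpace Ω} {P : Measure Ω}

/-- A set of `m`-measurable random vectors that is a module over the `m`-measurable functions,
contains all `P`-null vectors and is stable under countable `m`-measurable pasting. -/
structure IsStableModule (m : MeasurableSpace Ω) {mΩ : MeasurableSpace Ω} (P : Measure Ω)
    (M : Set (Ω → ι → ℝ)) : Prop where
  measurable : ∀ x ∈ M, Measurable[m] x
  null_mem : ∀ x : Ω → ι → ℝ, Measurable[m] x → (∀ᵐ ω ∂P, x ω = 0) → x ∈ M
  add_mem : ∀ x ∈ M, ∀ y ∈ M, (fun ω => x ω + y ω) ∈ M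
  smul_mem : ∀ c : Ω → ℝ, Measurable[m] c → ∀ x ∈ M, (fun ω => c ω • x ω) ∈ M
  paste_mem : ∀ N : Ω → ℕ, Measurable[m] N → ∀ x : ℕ → Ω → ι → ℝ, (∀ k, x k ∈ M) →
    (fun ω => x (N ω) ω) ∈ M

namespace IsStableModule

variable {M : Set (Ω → ι → ℝ)}

theorem measurable_coord (hM : IsStableModule m P M) {x : Ω → ι → ℝ} (hx : x ∈ M) (i : ι) :
    Measurable[m] fun ω => x ω i :=
  (measurable_pi_apply i).comp (hM.measurable x hx)

theorem exists_coord_ne_zero_iff (hM : IsStableModule m P M) (i : ι) (x : ℕ → Ω → ι → ℝ)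
    (hx : ∀ k, x k ∈ M) : ∃ y ∈ M, ∀ ω, y ω i ≠ 0 ↔ ∃ k, x k ω i ≠ 0 := by
  classical
  have hex : ∀ ω, ∃ k, x k ω i ≠ 0 ∨ ∀ l, x l ω i = 0 := by
    intro ω
    by_cases h : ∀ l, x l ω i = 0
    · exact ⟨0, Or.inr h⟩
    · push Not at h
      exact h.imp fun _ => Or.inl
  have hms : ∀ k, MeasurableSet[m] {ω | x k ω i = 0} := fun k =>
    hM.measurable_coord (hx k) i (measurableSet_singleton 0)
  have hN : Measurable[m] fun ω => Nat.find (hex ω) := by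
    refine measurable_find hex fun k => ?_
    have : {ω | x k ω i ≠ 0 ∨ ∀ l, x l ω i = 0}
        = {ω | x k ω i = 0}ᶜ ∪ ⋂ l, {ω | x l ω i = 0} := by
      ext ω
      simp
    rw [this]
    exact (hms k).compl.union (MeasurableSet.iInter hms)
  refine ⟨_, hM.paste_mem _ hN x hx, fun ω => ⟨fun h => ⟨_, h⟩, ?_⟩⟩
  rintro ⟨k, hk⟩
  exact (Nat.find_spec (hex ω)).resolve_right fun h => hk (h k)

theorem exists_maximal_support [IsFiniteMeasure P] (hm : m ≤ mΩ) (hM : IsStableModule m P M)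
    (i : ι) : ∃ e ∈ M, ∀ y ∈ M, ∀ᵐ ω ∂P, e ω i = 0 → y ω i = 0 := by
  let S : Set ENNReal := (fun x : Ω → ι → ℝ => P {ω | x ω i ≠ 0}) '' M
  have hS : S.Nonempty :=
    ⟨_, 0, hM.null_mem _ measurable_const (Eventually.of_forall fun _ => rfl), rfl⟩
  obtain ⟨u, -, hu, huS⟩ := exists_seq_tendsto_sSup hS (OrderTop.bddAbove S)
  choose x hxM hxu using huS
  obtain ⟨e, heM, he⟩ := hM.exists_coord_ne_zero_iff i x hxM
  have hle : sSup S ≤ P {ω | e ω i ≠ 0} := by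
    refine le_of_tendsto' hu fun k => ?_
    rw [← hxu k]
    exact measure_mono fun ω hω => (he ω).2 ⟨k, hω⟩
  refine ⟨e, heM, fun y hy => ?_⟩
  obtain ⟨w, hwM, hw⟩ := hM.exists_coord_ne_zero_iff i (fun k => if k = 0 then e else y)
    fun k => by split_ifs <;> assumption
  have hsub : {ω | e ω i ≠ 0} ⊆ {ω | w ω i ≠ 0} := fun ω hω => (hw ω).2 ⟨0, by simpa using hω⟩
  have hsup : P {ω | w ω i ≠ 0} ≤ P {ω | e ω i ≠ 0} :=
    (le_sSup (Set.mem_image_of_mem _ hwM)).trans hle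
  have hmeas : MeasurableSet {ω | e ω i ≠ 0} :=
    hm _ (hM.measurable_coord heM i (measurableSet_singleton 0).compl)
  have hnull : P ({ω | w ω i ≠ 0} \ {ω | e ω i ≠ 0}) = 0 := by
    rw [measure_sdiff hsub hmeas.nullMeasurableSet (measure_ne_top _ _)]
    exact tsub_eq_zero_of_le hsup
  filter_upwards [measure_eq_zero_iff_ae_notMem.1 hnull] with ω hω he0
  by_contra hy0
  exact hω ⟨(hw ω).2 ⟨1, by simpa using hy0⟩, fun h => h he0⟩

theorem exists_normalized [IsFiniteMeasure P] (hm : m ≤ mΩ) (hM : IsStableModule m P M)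
    (i : ι) : ∃ e ∈ M, ∀ y ∈ M, ∀ᵐ ω ∂P, y ω i * e ω i = y ω i := by
  obtain ⟨e, heM, he⟩ := hM.exists_maximal_support hm i
  refine ⟨_, hM.smul_mem (fun ω => (e ω i)⁻¹) (hM.measurable_coord heM i).inv e heM,
    fun y hy => ?_⟩
  filter_upwards [he y hy] with ω hω
  by_cases h : e ω i = 0
  · simp [hω h]
  · simp [h]

theorem coord_eq_zero (hM : IsStableModule m P M) (i : ι) :
    IsStableModule m P {x ∈ M | ∀ᵐ ω ∂P, x ω i = 0} where
  measurable x hx := hM.measurable x hx.1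
  null_mem x hx h := ⟨hM.null_mem x hx h, h.mono fun ω hω => by simp [hω]⟩
  add_mem x hx y hy := by
    refine ⟨hM.add_mem x hx.1 y hy.1, ?_⟩
    filter_upwards [hx.2, hy.2] with ω h₁ h₂
    simp [h₁, h₂]
  smul_mem c hc x hx := ⟨hM.smul_mem c hc x hx.1, hx.2.mono fun ω hω => by simp [hω]⟩
  paste_mem N hN x hx := ⟨hM.paste_mem N hN x fun k => (hx k).1,
    (ae_all_iff.2 fun k => (hx k).2).mono fun _ hω => hω _⟩

theorem exists_linearMap [Finite ι] [IsFiniteMeasure P] (hm : m ≤ mΩ) (s : Finset ι) :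
    ∀ M : Set (Ω → ι → ℝ), IsStableModule m P M → (∀ x ∈ M, ∀ i ∉ s, ∀ᵐ ω ∂P, x ω i = 0) →
    ∃ R : Ω → (ι → ℝ) →ₗ[ℝ] (ι → ℝ),
      Measurable[m.prod inferInstance] (fun r : Ω × (ι → ℝ) => R r.1 r.2) ∧
      ∀ x : Ω → ι → ℝ, Measurable[m] x → (x ∈ M ↔ ∀ᵐ ω ∂P, R ω (x ω) = 0) := by
  classical
  induction s using Finset.induction_on with
  | empty =>
    intro M hM h0
    refine ⟨fun _ => LinearMap.id, @measurable_snd Ω (ι → ℝ) m _,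
      fun x hx => ⟨fun h => ?_, hM.null_mem x hx⟩⟩
    filter_upwards [ae_all_iff.2 fun i => h0 x h i (Finset.notMem_empty i)] with ω hω
    exact funext hω
  | insert i s _ ih =>
    intro M hM h0
    obtain ⟨e, heM, he⟩ := hM.exists_normalized hm i
    obtain ⟨R, hR, hRM⟩ := ih _ (hM.coord_eq_zero i) (by
      rintro x ⟨hxM, hxi⟩ j hj
      by_cases hji : j = i
      · exact hji ▸ hxi
      · exact h0 x hxM j (by simp [hji, hj]))
    have heM' := hM.measurable e heM
    refine ⟨fun ω => R ω ∘ₗ (LinearMap.id - (LinearMap.proj i).smulRight (e ω)), ?_,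
      fun x hx => ?_⟩
    · let _ : MeasurableSpace Ω := m
      have : Measurable fun r : Ω × (ι → ℝ) => (r.1, r.2 - r.2 i • e r.1) := by fun_prop
      exact hR.comp this
    · have hxi : Measurable[m] fun ω => x ω i := (measurable_pi_apply i).comp hx
      have hred : Measurable[m] fun ω => x ω - x ω i • e ω := hx.sub (hxi.smul heM')
      have key : x ∈ M ↔ (fun ω => x ω - x ω i • e ω) ∈
          {x ∈ M | ∀ᵐ ω ∂P, x ω i = 0} := by
        constructor
        · intro h
          refine ⟨?_, (he x h).mono fun ω hω => by simp [hω]⟩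
          simpa [sub_eq_add_neg] using hM.add_mem x h _ (hM.smul_mem _ hxi.neg e heM)
        · rintro ⟨h, -⟩
          simpa using hM.add_mem _ h _ (hM.smul_mem _ hxi e heM)
      rw [key, hRM _ hred]
      simp

end IsStableModule

/-- The `t`-components of the processes that vanish before `t`, are adapted from `t` on and
are almost surely selections of a linear-valued mapping form a stable module. -/
theorem isStableModule_shadow {τ : Type*} [Preorder τ] {κ : τ → Type*} [∀ t, Finite (κ t)]
    (ℱ : Filtration τ mΩ)
    (L : Ω → Submodule ℝ (∀ t, κ t → ℝ)) (t : τ) :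
    IsStableModule (ℱ t) P {x : Ω → κ t → ℝ | Measurable[ℱ t] x ∧ ∃ z : Ω → ∀ s, κ s → ℝ,
      (∀ s, t ≤ s → Measurable[ℱ s] fun ω => z ω s) ∧
      ∀ᵐ ω ∂P, (∀ s < t, z ω s = 0) ∧ z ω t = x ω ∧ z ω ∈ L ω} where
  measurable x hx := hx.1
  null_mem x hx h := ⟨hx, 0, fun _ _ => measurable_const,
    h.mono fun ω hω => ⟨fun _ _ => rfl, hω.symm, (L ω).zero_mem⟩⟩
  add_mem := by
    rintro x ⟨hx, z, hz, hzL⟩ y ⟨hy, w, hw, hwL⟩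
    refine ⟨hx.add hy, fun ω => z ω + w ω, fun s hs => (hz s hs).add (hw s hs), ?_⟩
    filter_upwards [hzL, hwL] with ω h₁ h₂
    exact ⟨fun s hs => by simp [h₁.1 s hs, h₂.1 s hs], by simp [h₁.2.1, h₂.2.1],
      (L ω).add_mem h₁.2.2 h₂.2.2⟩
  smul_mem := by
    rintro c hc x ⟨hx, z, hz, hzL⟩
    refine ⟨hc.smul hx, fun ω => c ω • z ω,
      fun s hs => (hc.mono (ℱ.mono hs) le_rfl).smul (hz s hs), ?_⟩
    filter_upwards [hzL] with ω h
    exact ⟨fun s hs => by simp [h.1 s hs], by simp [h.2.1], (L ω).smul_mem _ h.2.2⟩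
  paste_mem := by
    intro N hN x hx
    choose hxm z hz hzL using hx
    have paste : ∀ {s : τ} {f : ℕ → Ω → κ s → ℝ}, t ≤ s → (∀ k, Measurable[ℱ s] (f k)) →
        Measurable[ℱ s] fun ω => f (N ω) ω := fun {s f} hs hf =>
      (measurable_from_prod_countable_right (f := fun r : ℕ × Ω => f r.1 r.2) hf).comp
        ((hN.mono (ℱ.mono hs) le_rfl).prodMk measurable_id)
    refine ⟨paste le_rfl hxm, fun ω => z (N ω) ω,
      fun s hs => paste (f := fun k ω => z k ω s) hs fun k => hz k s hs, ?_⟩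
    exact (ae_all_iff.2 hzL).mono fun ω h => h (N ω)

end StableModule

/-- Shadow projection of a measurable linear-valued mapping: for each time `t` there is an
`ℱ_t`-measurable linear-valued mapping `L_t` whose `ℱ_t`-measurable a.s. selections are
exactly the `t`-components `x_t` extendable by an adapted tail `(z_{t+1},…,z_T)` so that
`(0,…,0,x_t,z_{t+1},…,z_T)` selects `L` almost surely. -/
theorem measurable_linear_projection {Ω : Type*} [mΩ : MeasurableSpace Ω] (P : Measure Ω)
    [IsProbabilityMeasure P]
    (T : ℕ) (ℱ : Filtration (Fin (T + 1)) mΩ) (n : Fin (T + 1) → ℕ)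
    (L : Ω → Set (∀ t, Fin (n t) → ℝ))
    (hLlin : ∀ ω, ∃ S : Submodule ℝ (∀ t, Fin (n t) → ℝ), L ω = (S : Set (∀ t, Fin (n t) → ℝ)))
    (hLgraph : MeasurableSet {r : Ω × (∀ t, Fin (n t) → ℝ) | r.2 ∈ L r.1}) :
    ∀ t : Fin (T + 1), ∃ Lt : Ω → Set (Fin (n t) → ℝ),
      (∀ ω, ∃ S : Submodule ℝ (Fin (n t) → ℝ), Lt ω = (S : Set (Fin (n t) → ℝ))) ∧
      MeasurableSet[(ℱ t).prod inferInstance] {r : Ω × (Fin (n t) → ℝ) | r.2 ∈ Lt r.1} ∧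
      ∀ xt : Ω → Fin (n t) → ℝ, Measurable[ℱ t] xt →
        ((∃ z : Ω → ∀ s, Fin (n s) → ℝ,
            (∀ s, Measurable[ℱ s] fun ω => z ω s) ∧
            (∀ᵐ ω ∂P, (∀ s < t, z ω s = 0) ∧ z ω t = xt ω ∧ z ω ∈ L ω))
          ↔ ∀ᵐ ω ∂P, xt ω ∈ Lt ω) := by
  classical
  choose S hS using hLlin
  intro t
  obtain ⟨R, hR, hRM⟩ := IsStableModule.exists_linearMap (P := P) (ℱ.le t) Finset.univ _
    (isStableModule_shadow ℱ S t) fun _ _ i hi => absurd (Finset.mem_univ i) hi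
  refine ⟨fun ω => LinearMap.ker (R ω), fun ω => ⟨_, rfl⟩,
    hR (measurableSet_singleton 0), fun xt hxt => ?_⟩
  refine Iff.trans ?_ (hRM xt hxt)
  simp only [hS, SetLike.mem_coe]
  constructor
  · rintro ⟨z, hz, hzL⟩
    exact ⟨hxt, z, fun s _ => hz s, hzL⟩
  · rintro ⟨-, z, hz, hzL⟩
    refine ⟨fun ω s => if s < t then 0 else z ω s, fun s => ?_, ?_⟩
    · by_cases hs : s < t
      · simp only [hs, if_true]
        exact measurable_const
      · simpa only [hs, if_false] using hz s (not_lt.1 hs)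
    · filter_upwards [hzL] with ω h
      have : (fun s => if s < t then 0 else z ω s) = z ω := by
        funext s
        split_ifs with hs
        · exact (h.1 s hs).symm
        · rfl
      rw [this]
      exact ⟨fun s hs => by simp [hs], by simpa using h.2.1, h.2.2⟩
end

section
/- Let (Ω,ℱ,P) be a probability space with a filtration (ℱ_t)_{t=0}^T, 𝒩 the space of adapted processes x=(x_t)_{t=0}^T with x_t ∈ L^0(Ω,ℱ_t,P;ℝ^{n_t}), n = n_0+…+n_T, and p ∈ [1,∞). Let C : Ω ⇉ ℝ^n × ℝ^m be a set-valued mapping with closed convex values whose graph is ℱ⊗Borel(ℝ^n×ℝ^m)-measurable, and let C^∞(ω) denote the recession cone of C(ω), i.e. C^∞(ω) = {w : v + αw ∈ C(ω) for all v ∈ C(ω), α > 0}. If {x ∈ 𝒩 : (x(ω),0) ∈ C^∞(ω) P-a.s.} is a linear space, then the convex set 𝒞 := {u ∈ L^p(Ω,ℱ,P;ℝ^m) : ∃x ∈ 𝒩 with (x(ω),u(ω)) ∈ C(ω) P-a.s.} is closed in the norm topology of L^p (equivalently, since it is convex, weakly closed). -/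
open MeasureTheory Filter Topology
open scoped ENNReal

/-- A bounded sequence of measurable functions converges pointwise along a measurable
random subsequence. -/
theorem exists_measurable_subseq_tendsto {Ω : Type*} {mΩ : MeasurableSpace Ω}
    {z : ℕ → Ω → ℝ} (hz : ∀ k, Measurable (z k)) {b : ℝ} (hb : ∀ k ω, |z k ω| ≤ b) :
    ∃ (c : Ω → ℝ) (τ : ℕ → Ω → ℕ), Measurable c ∧ (∀ k, Measurable (τ k)) ∧
      (∀ k ω, k ≤ τ k ω) ∧ ∀ ω, Tendsto (fun k => z (τ k ω) ω) atTop (𝓝 (c ω)) := by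
  classical
  set c : Ω → ℝ := fun ω => limsup (fun k => z k ω) atTop with hc
  have hcm : Measurable c := Measurable.limsup hz
  have hbdd (ω : Ω) : IsBoundedUnder (· ≤ ·) atTop (fun k => z k ω) :=
    isBoundedUnder_of ⟨b, fun k => (abs_le.1 (hb k ω)).2⟩
  have hcobdd (ω : Ω) : IsCoboundedUnder (· ≤ ·) atTop (fun k => z k ω) :=
    IsBoundedUnder.isCoboundedUnder_le (isBoundedUnder_of ⟨-b, fun k => (abs_le.1 (hb k ω)).1⟩)
  have hex (k : ℕ) (ω : Ω) : ∃ j, k ≤ j ∧ |z j ω - c ω| < 1 / ((k : ℝ) + 1) := by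
    have hε : (0 : ℝ) < 1 / ((k : ℝ) + 1) := by positivity
    have h₁ : ∃ᶠ j in atTop, c ω - 1 / ((k : ℝ) + 1) < z j ω :=
      frequently_lt_of_lt_limsup (hcobdd ω) (by simp only [hc]; linarith)
    have h₂ : ∀ᶠ j in atTop, z j ω < c ω + 1 / ((k : ℝ) + 1) :=
      eventually_lt_of_limsup_lt (by simp only [hc]; linarith) (hbdd ω)
    obtain ⟨j, hj₁, hj₂, hj₃⟩ := (h₁.and_eventually (h₂.and (eventually_ge_atTop k))).exists
    exact ⟨j, hj₃, abs_lt.2 ⟨by linarith, by linarith⟩⟩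
  refine ⟨c, fun k ω => Nat.find (hex k ω), hcm, fun k => measurable_find _ fun j => ?_,
    fun k ω => (Nat.find_spec (hex k ω)).1, fun ω => ?_⟩
  · exact (MeasurableSet.const _).inter
      (measurableSet_lt (((hz j).sub hcm).abs) measurable_const)
  · rw [tendsto_iff_dist_tendsto_zero]
    exact squeeze_zero (fun _ => dist_nonneg) (fun k => (Nat.find_spec (hex k ω)).2.le)
      tendsto_one_div_add_atTop_nhds_zero_nat

/-- Evaluating a sequence of measurable functions at a measurable random index. -/
theorem Measurable.eval_random_index {Ω β : Type*} {mΩ : MeasurableSpace Ω}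
    [MeasurableSpace β] {x : ℕ → Ω → β} (hx : ∀ k, Measurable (x k)) {τ : Ω → ℕ}
    (hτ : Measurable τ) : Measurable fun ω => x (τ ω) ω :=
  (measurable_from_prod_countable_right (f := fun q : ℕ × Ω => x q.1 q.2) hx).comp
    (hτ.prodMk measurable_id)

/-- Closedness of adapted projections of random closed convex cones `K ω`: the directions
`e i`, `i ∈ s`, carry coefficients measurable with respect to `G (d i)`, and the adapted
combinations lying in `K` form a symmetric set. -/
theorem exists_adapted_limit_mem_cone {Ω V ι τ : Type*} {mΩ : MeasurableSpace Ω}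
    (P : Measure Ω) [AddCommGroup V] [Module ℝ V] [TopologicalSpace V]
    [IsTopologicalAddGroup V] [ContinuousSMul ℝ V] [DecidableEq ι] [LinearOrder τ]
    (d : ι → τ) {G : τ → MeasurableSpace Ω} (hG : Monotone G) (e : ι → V)
    {K : Ω → Set V} (hclosed : ∀ ω, IsClosed (K ω))
    (hadd : ∀ ω, ∀ v ∈ K ω, ∀ w ∈ K ω, v + w ∈ K ω)
    (hsmul : ∀ ω, ∀ v ∈ K ω, ∀ r : ℝ, 0 ≤ r → r • v ∈ K ω) (s : Finset ι) :
    (∀ x : ι → Ω → ℝ, (∀ i ∈ s, Measurable[G (d i)] (x i)) →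
      (∀ᵐ ω ∂P, ∑ i ∈ s, x i ω • e i ∈ K ω) → ∀ᵐ ω ∂P, -∑ i ∈ s, x i ω • e i ∈ K ω) →
    ∀ (v : ℕ → Ω → V) (v' : Ω → V) (x : ℕ → ι → Ω → ℝ),
      (∀ᵐ ω ∂P, Tendsto (fun k => v k ω) atTop (𝓝 (v' ω))) →
      (∀ k, ∀ i ∈ s, Measurable[G (d i)] (x k i)) →
      (∀ᵐ ω ∂P, ∀ k, v k ω + ∑ i ∈ s, x k i ω • e i ∈ K ω) →
      ∃ y : ι → Ω → ℝ, (∀ i ∈ s, Measurable[G (d i)] (y i)) ∧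
        ∀ᵐ ω ∂P, v' ω + ∑ i ∈ s, y i ω • e i ∈ K ω := by
  classical
  induction s using Finset.induction_on_min_value d with
  | empty =>
    intro _ v v' x hv _ hx
    refine ⟨fun _ _ => 0, fun i _ => measurable_const, ?_⟩
    filter_upwards [hv, hx] with ω hvω hxω
    simp only [Finset.sum_empty, add_zero] at hxω ⊢
    exact (hclosed ω).mem_of_tendsto hvω (Eventually.of_forall hxω)
  | insert a s has hmin ih =>
    intro hL v v' x hv hxm hx
    have hsum_update (y : ι → Ω → ℝ) (f : Ω → ℝ) (ω : Ω) :
        ∑ i ∈ insert a s, Function.update y a f i ω • e i =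
          f ω • e a + ∑ i ∈ s, y i ω • e i := by
      rw [Finset.sum_insert has, Function.update_self]
      congr 1
      refine Finset.sum_congr rfl fun i hi => ?_
      rw [Function.update_of_ne (ne_of_mem_of_not_mem hi has)]
    have hupdate_meas {y : ι → Ω → ℝ} (hy : ∀ i ∈ s, Measurable[G (d i)] (y i)) {f : Ω → ℝ}
        (hf : Measurable[G (d a)] f) (i : ι) (hi : i ∈ insert a s) :
        Measurable[G (d i)] (Function.update y a f i) := by
      rcases eq_or_ne i a with rfl | hia
      · rwa [Function.update_self]
      · rw [Function.update_of_ne hia]; exact hy i (Finset.mem_of_mem_insert_of_ne hi hia)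
    have hle {i : ι} (hi : i ∈ s) {f : Ω → ℝ} (hf : Measurable[G (d a)] f) :
        Measurable[G (d i)] f := hf.mono (hG (hmin i hi)) le_rfl
    specialize ih fun y hy hyK => by
      have h := hL (Function.update y a fun _ => 0) (hupdate_meas hy measurable_const)
      simp only [hsum_update, zero_smul, zero_add] at h
      exact h hyK
    -- normalise the first coefficient to lie in `[-1, 1]` and pass to a convergent subsequence
    have hxa (k : ℕ) : Measurable[G (d a)] (x k a) := hxm k a (Finset.mem_insert_self a s)
    obtain ⟨c, τ, hc, hτ, hτk, hlim⟩ := @exists_measurable_subseq_tendsto Ω (G (d a))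
      (fun k ω => x k a ω / (1 + |x k a ω|))
      (fun k => (hxa k).div (measurable_const.add (continuous_abs.measurable.comp (hxa k)))) 1
      (fun k ω => by
        rw [abs_div, abs_of_pos (by positivity : 0 < 1 + |x k a ω|), div_le_one (by positivity)]
        linarith)
    set X : ℕ → ι → Ω → ℝ := fun k i ω => x (τ k ω) i ω with hX
    have hXa (k : ℕ) : Measurable[G (d a)] (X k a) := Measurable.eval_random_index hxa (hτ k)
    have hXm (k : ℕ) (i : ι) (hi : i ∈ s) : Measurable[G (d i)] (X k i) :=
      Measurable.eval_random_index (fun k => hxm k i (Finset.mem_insert_of_mem hi))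
        ((hτ k).mono (hG (hmin i hi)) le_rfl)
    have hXv : ∀ᵐ ω ∂P, Tendsto (fun k => v (τ k ω) ω) atTop (𝓝 (v' ω)) := by
      filter_upwards [hv] with ω hω
      exact hω.comp (tendsto_atTop_mono (fun k => hτk k ω) tendsto_id)
    have hXK : ∀ᵐ ω ∂P, ∀ k,
        v (τ k ω) ω + (X k a ω • e a + ∑ i ∈ s, X k i ω • e i) ∈ K ω := by
      filter_upwards [hx] with ω hω k
      simpa only [Finset.sum_insert has] using hω (τ k ω)
    set q : ℕ → Ω → ℝ := fun k ω => 1 / (1 + |X k a ω|) with hq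
    have hqm (k : ℕ) : Measurable[G (d a)] (q k) :=
      measurable_const.div (measurable_const.add (continuous_abs.measurable.comp (hXa k)))
    have hq0 (k : ℕ) (ω : Ω) : 0 < q k ω := by positivity
    have hlim' (ω : Ω) : Tendsto (fun k => q k ω * X k a ω) atTop (𝓝 (c ω)) :=
      (hlim ω).congr fun k => by simp only [hq, hX]; ring
    have hqlim (ω : Ω) : Tendsto (fun k => q k ω) atTop (𝓝 (1 - |c ω|)) :=
      (tendsto_const_nhds.sub (hlim' ω).abs).congr fun k => by
        rw [abs_mul, abs_of_pos (hq0 k ω)]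
        simp only [hq]
        field_simp
        ring
    -- the indicator of the event on which the first coefficient blows up
    set χ : Ω → ℝ := fun ω => if |c ω| = 1 then 1 else 0 with hχ
    have hχm : Measurable[G (d a)] χ :=
      Measurable.ite ((continuous_abs.measurable.comp hc) (measurableSet_singleton 1))
        measurable_const measurable_const
    have hχ0 (ω : Ω) : 0 ≤ χ ω := by simp only [hχ]; split_ifs <;> norm_num
    have hχq (ω : Ω) : Tendsto (fun k => χ ω * q k ω) atTop (𝓝 0) := by
      have h := (hqlim ω).const_mul (χ ω)
      have h0 : χ ω * (1 - |c ω|) = 0 := by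
        simp only [hχ]; split_ifs with h1 <;> simp [h1]
      rwa [h0] at h
    have hχc (ω : Ω) : χ ω * c ω * (χ ω * c ω) = χ ω := by
      simp only [hχ]
      split_ifs with h1
      · rw [one_mul, ← abs_mul_abs_self, h1, one_mul]
      · simp
    obtain ⟨z, hzm, hzK⟩ := ih
      (fun k ω => (χ ω * q k ω) • v (τ k ω) ω + (χ ω * (q k ω * X k a ω)) • e a)
      (fun ω => (χ ω * c ω) • e a) (fun k i ω => χ ω * q k ω * X k i ω)
      (by
        filter_upwards [hXv] with ω hω
        simpa using ((hχq ω).smul hω).add (((hlim' ω).const_mul (χ ω)).smul_const (e a)))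
      (fun k i hi => ((hle hi hχm).mul (hle hi (hqm k))).mul (hXm k i hi))
      (by
        filter_upwards [hXK] with ω hω k
        have h := hsmul ω _ (hω k) (χ ω * q k ω) (mul_nonneg (hχ0 ω) (hq0 k ω).le)
        simpa only [smul_add, Finset.smul_sum, smul_smul, mul_assoc, add_assoc] using h)
    have hzK' : ∀ᵐ ω ∂P, -((χ ω * c ω) • e a + ∑ i ∈ s, z i ω • e i) ∈ K ω := by
      have h := hL (Function.update z a fun ω => χ ω * c ω) (hupdate_meas hzm (hχm.mul hc))
      simp only [hsum_update] at h
      exact h hzK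
    -- eliminate the first coefficient on this event
    obtain ⟨y, hym, hyK⟩ := ih
      (fun k ω => v (τ k ω) ω + ((1 - χ ω) * X k a ω) • e a)
      (fun ω => v' ω + ((1 - χ ω) * (c ω / (1 - |c ω|))) • e a)
      (fun k i ω => X k i ω - X k a ω * (χ ω * c ω) * z i ω)
      (by
        filter_upwards [hXv] with ω hω
        refine hω.add (Tendsto.smul_const ?_ _)
        by_cases h1 : |c ω| = 1
        · simp [hχ, h1]
        · refine Tendsto.const_mul _ (((hlim' ω).div (hqlim ω)
            (sub_ne_zero.2 (Ne.symm h1))).congr fun k => ?_)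
          exact mul_div_cancel_left₀ _ (hq0 k ω).ne')
      (fun k i hi => (hXm k i hi).sub
        (((hle hi (hXa k)).mul (hle hi (hχm.mul hc))).mul (hzm i hi)))
      (by
        filter_upwards [hXK, hzK, hzK'] with ω hω hz hz' k
        have hD : (-(X k a ω * (χ ω * c ω))) •
            ((χ ω * c ω) • e a + ∑ i ∈ s, z i ω • e i) ∈ K ω := by
          rcases le_total 0 (-(X k a ω * (χ ω * c ω))) with h | h
          · exact hsmul ω _ hz _ h
          · simpa only [smul_neg, neg_smul, neg_neg] using
              hsmul ω _ hz' (X k a ω * (χ ω * c ω)) (by linarith)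
        have h := hadd ω _ (hω k) _ hD
        have hcoef : (1 - χ ω) * X k a ω =
            X k a ω + -(X k a ω * (χ ω * c ω)) * (χ ω * c ω) := by
          linear_combination X k a ω * hχc ω
        convert h using 1
        simp only [hcoef, add_smul, sub_smul, smul_add, Finset.smul_sum, smul_smul,
          Finset.sum_sub_distrib, neg_mul, neg_smul, Finset.sum_neg_distrib]
        abel)
    refine ⟨Function.update y a fun ω => (1 - χ ω) * (c ω / (1 - |c ω|)),
      hupdate_meas hym ((measurable_const.sub hχm).mul
        (hc.div (measurable_const.sub (continuous_abs.measurable.comp hc)))), ?_⟩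
    filter_upwards [hyK] with ω hω
    simpa only [hsum_update, add_assoc] using hω

/-- The closed homogenization of a set `C`: the pairs `(w, l)` with `l ≥ 0` such that `C` is
stable under `v ↦ (1 - α l) v + α w` whenever `α ≥ 0` and `α l < 1`. When `C` is a nonempty
closed convex set, its slice at `l = 1` is `C` and its slice at `l = 0` is the recession cone. -/
def homogenization {E : Type*} [AddCommGroup E] [Module ℝ E] (C : Set E) : Set (E × ℝ) :=
  {q | 0 ≤ q.2 ∧ ∀ v ∈ C, ∀ α : ℝ, 0 ≤ α → α * q.2 < 1 → (1 - α * q.2) • v + α • q.1 ∈ C}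

section homogenization

variable {E : Type*} [AddCommGroup E] [Module ℝ E] {C : Set E}

theorem homogenization_add {q₁ q₂ : E × ℝ} (h₁ : q₁ ∈ homogenization C)
    (h₂ : q₂ ∈ homogenization C) : q₁ + q₂ ∈ homogenization C := by
  obtain ⟨w₁, l₁⟩ := q₁
  obtain ⟨w₂, l₂⟩ := q₂
  obtain ⟨hl₁, h₁⟩ := h₁
  obtain ⟨hl₂, h₂⟩ := h₂
  refine ⟨add_nonneg hl₁ hl₂, fun v hv α hα hlt => ?_⟩
  simp only [Prod.fst_add, Prod.snd_add] at *
  have hα₁ : 0 ≤ α * l₁ := mul_nonneg hα hl₁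
  have hpos : 0 < 1 - α * l₂ := by linarith
  have h := h₂ _ (h₁ v hv (α / (1 - α * l₂)) (by positivity)
    (by rw [div_mul_eq_mul_div, div_lt_one hpos]; linarith)) α hα (by linarith)
  convert h using 1
  rw [smul_add (1 - α * l₂), smul_smul, smul_smul, mul_div_cancel₀ _ hpos.ne', smul_add, add_assoc]
  congr 2
  field_simp
  ring

theorem homogenization_smul {q : E × ℝ} (h : q ∈ homogenization C) {r : ℝ} (hr : 0 ≤ r) :
    r • q ∈ homogenization C := by
  refine ⟨mul_nonneg hr h.1, fun v hv α hα hlt => ?_⟩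
  have h' := h.2 v hv (α * r) (mul_nonneg hα hr) (by simpa [mul_assoc] using hlt)
  simpa [smul_smul, mul_assoc] using h'

theorem mem_homogenization_zero {w : E} :
    (w, (0 : ℝ)) ∈ homogenization C ↔ w ∈ recessionCone C := by
  constructor
  · intro h v hv α hα
    simpa using h.2 v hv α hα.le (by simp)
  · refine fun h => ⟨le_rfl, fun v hv α hα _ => ?_⟩
    rcases hα.eq_or_lt with rfl | hα
    · simpa using hv
    · simpa using h v hv α hα

theorem mem_homogenization_one (hC : Convex ℝ C) {w : E} (hw : w ∈ C) :
    (w, (1 : ℝ)) ∈ homogenization C := by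
  refine ⟨zero_le_one, fun v hv α hα hlt => ?_⟩
  rw [mul_one] at hlt ⊢
  exact hC hv hw (by linarith) hα (by ring)

variable [TopologicalSpace E] [IsTopologicalAddGroup E] [ContinuousSMul ℝ E]

theorem isClosed_homogenization (hC : IsClosed C) : IsClosed (homogenization C) := by
  simp only [homogenization, Set.ofPred_and, Set.ofPred_forall]
  refine (isClosed_le continuous_const continuous_snd).inter <|
    isClosed_iInter fun v => isClosed_iInter fun _ => isClosed_iInter fun α =>
    isClosed_iInter fun _ => ?_
  simp only [imp_iff_not_or, not_lt]
  exact (isClosed_le continuous_const (continuous_const.mul continuous_snd)).union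
    (hC.preimage (f := fun q : E × ℝ => (1 - α * q.2) • v + α • q.1) (by fun_prop))

theorem mem_of_mem_homogenization_one (hC : IsClosed C) (hne : C.Nonempty) {w : E}
    (h : (w, (1 : ℝ)) ∈ homogenization C) : w ∈ C := by
  obtain ⟨v, hv⟩ := hne
  have hlim : Tendsto (fun α : ℝ => (1 - α * 1) • v + α • w) (𝓝[<] 1) (𝓝 w) := by
    have hcont : Continuous fun α : ℝ => (1 - α * 1) • v + α • w := by fun_prop
    simpa using (hcont.tendsto 1).mono_left nhdsWithin_le_nhds
  refine hC.mem_of_tendsto hlim ?_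
  filter_upwards [Ioo_mem_nhdsLT (zero_lt_one (α := ℝ))] with α hα
  exact h.2 v hv α hα.1.le (by simpa using hα.2)

end homogenization

/-- **Closedness of the projection**: if the adapted selections `x` of
`{x : (x,0) ∈ C^∞}` form a linear space, then the set of `u ∈ L^p` for which some
adapted `x` satisfies `(x,u) ∈ C` almost surely is closed in `L^p`. -/
theorem projection_closed {Ω : Type*} [mΩ : MeasurableSpace Ω] (P : Measure Ω)
    [IsProbabilityMeasure P]
    (T : ℕ) (ℱ : Filtration (Fin (T + 1)) mΩ) (n : Fin (T + 1) → ℕ) (m : ℕ)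
    (p : ℝ≥0∞) [Fact (1 ≤ p)] (hp' : p ≠ ⊤)
    (C : Ω → Set ((∀ t, Fin (n t) → ℝ) × (Fin m → ℝ)))
    (hCclosed : ∀ ω, IsClosed (C ω))
    (hCconvex : ∀ ω, Convex ℝ (C ω))
    (hCgraph : MeasurableSet {r : Ω × ((∀ t, Fin (n t) → ℝ) × (Fin m → ℝ)) | r.2 ∈ C r.1})
    (hlin : ∀ (x₁ x₂ : Ω → ∀ t, Fin (n t) → ℝ) (c₁ c₂ : ℝ),
      (∀ t, Measurable[ℱ t] fun ω => x₁ ω t) →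
      (∀ t, Measurable[ℱ t] fun ω => x₂ ω t) →
      (∀ᵐ ω ∂P, (x₁ ω, 0) ∈ recessionCone (C ω)) →
      (∀ᵐ ω ∂P, (x₂ ω, 0) ∈ recessionCone (C ω)) →
      (∀ᵐ ω ∂P, (c₁ • x₁ ω + c₂ • x₂ ω, 0) ∈ recessionCone (C ω))) :
    IsClosed {u : Lp (Fin m → ℝ) p P |
      ∃ x : Ω → ∀ t, Fin (n t) → ℝ,
        (∀ t, Measurable[ℱ t] fun ω => x ω t) ∧ ∀ᵐ ω ∂P, (x ω, u ω) ∈ C ω} := by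
  refine IsSeqClosed.isClosed fun u u' hu hlim => ?_
  choose x hxm hxC using hu
  obtain ⟨σ, -, hσ⟩ := (tendstoInMeasure_of_tendsto_Lp hlim).exists_seq_tendsto_ae
  let e : (Σ t, Fin (n t)) → ((∀ t, Fin (n t) → ℝ) × (Fin m → ℝ)) × ℝ :=
    fun i => ((Pi.single i.1 (Pi.single i.2 1), 0), 0)
  have he (y : (Σ t, Fin (n t)) → ℝ) :
      ∑ i, y i • e i = (((fun t j => y ⟨t, j⟩), 0), 0) := by
    refine Prod.ext (Prod.ext (funext fun t => funext fun j => ?_) ?_) ?_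
    · simp only [Prod.fst_sum, Finset.sum_apply]
      rw [Finset.sum_eq_single ⟨t, j⟩]
      · simp [e]
      · rintro ⟨t', j'⟩ - hne
        rcases eq_or_ne t t' with rfl | ht
        · have hj : j ≠ j' := by rintro rfl; exact hne rfl
          simp [e, hj]
        · simp [e, ht]
      · simp
    · simp [e, Prod.snd_sum, Prod.fst_sum]
    · simp [e, Prod.snd_sum]
  obtain ⟨y, hym, hyK⟩ := exists_adapted_limit_mem_cone P Sigma.fst (G := ℱ) ℱ.mono' e
    (K := fun ω => homogenization (C ω)) (fun ω => isClosed_homogenization (hCclosed ω))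
    (fun ω v hv w hw => homogenization_add hv hw)
    (fun ω v hv r hr => homogenization_smul hv hr) Finset.univ
    (by
      intro y hym hyK
      have hm (t) : Measurable[ℱ t] fun ω j => y ⟨t, j⟩ ω :=
        @measurable_pi_lambda _ _ _ (ℱ t) _ _ fun j => hym ⟨t, j⟩ (Finset.mem_univ _)
      simp only [he, mem_homogenization_zero] at hyK
      filter_upwards [hlin _ _ (-1) 0 hm hm hyK hyK] with ω hω
      rw [he, Prod.neg_mk, neg_zero, mem_homogenization_zero, Prod.neg_mk, neg_zero]
      simpa using hω)
    (fun k ω => ((0, u (σ k) ω), 1)) (fun ω => ((0, u' ω), 1))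
    (fun k i ω => x (σ k) ω i.1 i.2)
    (by
      filter_upwards [hσ] with ω hω
      exact (tendsto_const_nhds.prodMk_nhds hω).prodMk_nhds tendsto_const_nhds)
    (fun k i _ => (measurable_pi_apply i.2).comp (hxm (σ k) i.1))
    (by
      filter_upwards [ae_all_iff.2 hxC] with ω hω k
      simpa [he] using mem_homogenization_one (hCconvex ω) (hω (σ k)))
  refine ⟨fun ω t j => y ⟨t, j⟩ ω,
    fun t => @measurable_pi_lambda _ _ _ (ℱ t) _ _ fun j => hym ⟨t, j⟩ (Finset.mem_univ _), ?_⟩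
  filter_upwards [hyK, hxC 0] with ω hω hne
  refine mem_of_mem_homogenization_one (hCclosed ω) ⟨_, hne⟩ ?_
  simpa [he] using hω
end

section
/- Let (Ω,ℱ,P) be a probability space with a filtration (ℱ_t)_{t=0}^T and let x = (x_t)_{t=0}^T be an adapted real-valued process with x_t ≥ 0 and Σ_{t=0}^T x_t ≤ 1 P-a.s. Then there exists a sequence (x^ν)_{ν=1}^∞ of processes, each of which is a finite convex combination of processes of the form (1_{τ = t})_{t=0}^T for stopping times τ : Ω → {0,1,…,T,∞} of the filtration, such that E[Σ_{t=0}^T x^ν_t v_t] → E[Σ_{t=0}^T x_t v_t] for every v = (v_t)_{t=0}^T with each v_t integrable; in particular x^ν → x in the weak* topology σ(L^∞,L^1). Moreover x^ν_t → x_t almost surely for each t. -/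
open MeasureTheory Filter Topology
open scoped ENNReal

namespace RelaxedStopping

/-- The sum of the positive parts of the first `n` entries of `x`. -/
noncomputable def partialSum {T : ℕ} (x : Fin (T + 1) → ℝ) (n : ℕ) : ℝ :=
  ∑ s : Fin (T + 1), if (s : ℕ) < n then max (x s) 0 else 0

lemma partialSum_zero {T : ℕ} (x : Fin (T + 1) → ℝ) : partialSum x 0 = 0 := by
  simp [partialSum]

lemma partialSum_mono {T : ℕ} (x : Fin (T + 1) → ℝ) : Monotone (partialSum x) := by
  intro m n hmn
  refine Finset.sum_le_sum fun s _ => ?_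
  have h0 : 0 ≤ max (x s) 0 := le_max_right _ _
  split_ifs
  · exact le_rfl
  · omega
  · exact h0
  · exact le_rfl

lemma partialSum_nonneg {T : ℕ} (x : Fin (T + 1) → ℝ) (n : ℕ) : 0 ≤ partialSum x n := by
  simpa [partialSum_zero] using partialSum_mono x (Nat.zero_le n)

lemma partialSum_le_one {T : ℕ} {x : Fin (T + 1) → ℝ} (h0 : ∀ t, 0 ≤ x t)
    (h1 : ∑ t, x t ≤ 1) (n : ℕ) : partialSum x n ≤ 1 := by
  refine le_trans (Finset.sum_le_sum fun s _ => ?_) h1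
  split_ifs
  · exact (max_eq_left (h0 s)).le
  · exact h0 s

lemma partialSum_succ_sub {T : ℕ} {x : Fin (T + 1) → ℝ} (t : Fin (T + 1)) (h0 : 0 ≤ x t) :
    partialSum x (t + 1) - partialSum x t = x t := by
  unfold partialSum
  rw [← Finset.sum_sub_distrib, Finset.sum_eq_single t]
  · simp [h0]
  · intro s _ hs
    have hne : (s : ℕ) ≠ t := fun h => hs (Fin.ext h)
    have hiff : (s : ℕ) < t + 1 ↔ (s : ℕ) < t := by omega
    simp [hiff]
  · simp

lemma measurable_partialSum {Ω : Type*} {mΩ : MeasurableSpace Ω} {T : ℕ}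
    {ℱ : Filtration (Fin (T + 1)) mΩ} {x : Fin (T + 1) → Ω → ℝ}
    (hx : ∀ t, Measurable[ℱ t] (x t)) (t : Fin (T + 1)) {n : ℕ} (hn : n ≤ t + 1) :
    Measurable[ℱ t] fun ω => partialSum (fun s => x s ω) n := by
  unfold partialSum
  refine Finset.measurable_sum _ fun s _ => ?_
  split_ifs with h
  · have hst : s ≤ t := Fin.le_def.2 (by omega)
    exact ((hx s).mono (ℱ.mono hst) le_rfl).max measurable_const
  · exact measurable_const

open Classical in
/-- The first index at which the sequence `S`, shifted by one, exceeds the level `c`. -/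
noncomputable def crossingTime (S : ℕ → ℝ) (c : ℝ) : ℕ∞ :=
  if h : ∃ n, c < S (n + 1) then (Nat.find h : ℕ∞) else ⊤

lemma crossingTime_eq_iff {S : ℕ → ℝ} (hS : Monotone S) {c : ℝ} (h0 : S 0 ≤ c) (t : ℕ) :
    crossingTime S c = (t : ℕ∞) ↔ S t ≤ c ∧ c < S (t + 1) := by
  classical
  unfold crossingTime
  split_ifs with h
  · rw [Nat.cast_inj, Nat.find_eq_iff]
    constructor
    · rintro ⟨h1, h2⟩
      refine ⟨?_, h1⟩
      cases t with
      | zero => exact h0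
      | succ n => exact not_lt.1 (h2 n n.lt_succ_self)
    · rintro ⟨h1, h2⟩
      exact ⟨h2, fun n hn => not_lt.2 ((hS hn).trans h1)⟩
  · push Not at h
    constructor
    · intro h'
      exact absurd h' (ENat.top_ne_natCast t)
    · rintro ⟨_, h2⟩
      exact absurd h2 (not_lt.2 (h t))

/-- The proportion of the grid points `i / (ν + 1)`, `i ≤ ν`, below `a`. -/
noncomputable def gridCount (ν : ℕ) (a : ℝ) : ℝ :=
  ∑ i : Fin (ν + 1), 1 / ((ν : ℝ) + 1) * (if (i : ℝ) / ((ν : ℝ) + 1) < a then 1 else 0)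

lemma gridCount_eq (ν : ℕ) {a : ℝ} (h1 : a ≤ 1) :
    gridCount ν a = (⌈a * ((ν + 1 : ℕ) : ℝ)⌉₊ : ℝ) / ((ν + 1 : ℕ) : ℝ) := by
  have hpos : (0 : ℝ) < (ν : ℝ) + 1 := by positivity
  have hle : ⌈a * ((ν + 1 : ℕ) : ℝ)⌉₊ ≤ ν + 1 := by
    refine Nat.ceil_le.2 ?_
    push_cast
    nlinarith
  have hfilter : (Finset.range (ν + 1)).filter (fun i : ℕ => (i : ℝ) / ((ν : ℝ) + 1) < a)
      = Finset.range ⌈a * ((ν + 1 : ℕ) : ℝ)⌉₊ := by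
    ext i
    rw [Finset.mem_filter, Finset.mem_range, Finset.mem_range, Nat.lt_ceil, div_lt_iff₀ hpos]
    push_cast
    refine ⟨fun h => h.2, fun h => ⟨?_, h⟩⟩
    exact lt_of_lt_of_le (Nat.lt_ceil.2 (by push_cast; exact h)) hle
  unfold gridCount
  rw [← Finset.mul_sum, Fin.sum_univ_eq_sum_range
    (fun i : ℕ => if (i : ℝ) / ((ν : ℝ) + 1) < a then (1 : ℝ) else 0), Finset.sum_boole, hfilter,
    Finset.card_range]
  push_cast
  ring

lemma tendsto_gridCount {a : ℝ} (h0 : 0 ≤ a) (h1 : a ≤ 1) :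
    Tendsto (fun ν => gridCount ν a) atTop (𝓝 a) := by
  simp_rw [gridCount_eq _ h1]
  exact (tendsto_nat_ceil_mul_div_atTop h0).comp
    (tendsto_natCast_atTop_atTop.comp (tendsto_add_atTop_nat 1))

/-- Pointwise convergence of uniformly bounded processes implies weak* convergence. -/
lemma tendsto_integral_sum_mul {Ω ι : Type*} [Fintype ι] [MeasurableSpace Ω] {P : Measure Ω}
    {y : ℕ → ι → Ω → ℝ} {x v : ι → Ω → ℝ} (hy : ∀ ν t, Measurable (y ν t))
    (hbound : ∀ ν t ω, |y ν t ω| ≤ 1)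
    (hlim : ∀ t, ∀ᵐ ω ∂P, Tendsto (fun ν => y ν t ω) atTop (𝓝 (x t ω)))
    (hv : ∀ t, Integrable (v t) P) :
    Tendsto (fun ν => ∫ ω, ∑ t, y ν t ω * v t ω ∂P) atTop (𝓝 (∫ ω, ∑ t, x t ω * v t ω ∂P)) := by
  refine tendsto_integral_of_dominated_convergence (fun ω => ∑ t, ‖v t ω‖) ?_ ?_ ?_ ?_
  · intro ν
    exact Finset.aestronglyMeasurable_fun_sum _ fun t _ =>
      (hy ν t).aestronglyMeasurable.mul (hv t).aestronglyMeasurable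
  · exact integrable_finsetSum _ fun t _ => (hv t).norm
  · refine fun ν => ae_of_all _ fun ω => (norm_sum_le _ _).trans (Finset.sum_le_sum fun t _ => ?_)
    rw [norm_mul]
    exact mul_le_of_le_one_left (norm_nonneg _) (hbound ν t ω)
  · filter_upwards [ae_all_iff.2 hlim] with ω hω
    exact tendsto_finsetSum _ fun t _ => (hω t).mul_const _

end RelaxedStopping

open RelaxedStopping

/-- A randomized stopping rule (an adapted process `x ≥ 0` with `∑_t x_t ≤ 1` a.s.) is the
almost sure and weak* limit of convex combinations of genuine stopping strategies. -/
theorem relaxed_stopping_approximation {Ω : Type*} [mΩ : MeasurableSpace Ω] (P : Measure Ω)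
    [IsProbabilityMeasure P]
    (T : ℕ) (ℱ : Filtration (Fin (T + 1)) mΩ)
    (x : Fin (T + 1) → Ω → ℝ)
    (hadapted : ∀ t, Measurable[ℱ t] (x t))
    (hx : ∀ᵐ ω ∂P, (∀ t, 0 ≤ x t ω) ∧ ∑ t, x t ω ≤ 1) :
    ∃ xseq : ℕ → Fin (T + 1) → Ω → ℝ,
      (∀ ν, ∃ (N : ℕ) (lam : Fin N → ℝ) (τ : Fin N → Ω → ℕ∞),
        (∀ i, ∀ t : Fin (T + 1), MeasurableSet[ℱ t] {ω | τ i ω = ((t : ℕ) : ℕ∞)}) ∧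
        (∀ i, 0 ≤ lam i) ∧ (∑ i, lam i) = 1 ∧
        (∀ t ω, xseq ν t ω = ∑ i, lam i * (if τ i ω = ((t : ℕ) : ℕ∞) then 1 else 0))) ∧
      (∀ v : Fin (T + 1) → Ω → ℝ, (∀ t, Integrable (v t) P) →
        Tendsto (fun ν => ∫ ω, ∑ t, xseq ν t ω * v t ω ∂P) atTop
          (nhds (∫ ω, ∑ t, x t ω * v t ω ∂P))) ∧
      (∀ t, ∀ᵐ ω ∂P, Tendsto (fun ν => xseq ν t ω) atTop (nhds (x t ω))) := by
  let S : Ω → ℕ → ℝ := fun ω => partialSum (fun s => x s ω)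
  let τ : (ν : ℕ) → Fin (ν + 1) → Ω → ℕ∞ := fun ν i ω =>
    crossingTime (S ω) ((i : ℝ) / ((ν : ℝ) + 1))
  let y : ℕ → Fin (T + 1) → Ω → ℝ := fun ν t ω =>
    ∑ i, 1 / ((ν : ℝ) + 1) * (if τ ν i ω = ((t : ℕ) : ℕ∞) then 1 else 0)
  have hτ (ν i ω) (t : ℕ) : τ ν i ω = (t : ℕ∞) ↔
      S ω t ≤ (i : ℝ) / ((ν : ℝ) + 1) ∧ (i : ℝ) / ((ν : ℝ) + 1) < S ω (t + 1) := by
    refine crossingTime_eq_iff (partialSum_mono _) ?_ t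
    rw [partialSum_zero]
    positivity
  have hmeas (ν i) (t : Fin (T + 1)) :
      MeasurableSet[ℱ t] {ω | τ ν i ω = ((t : ℕ) : ℕ∞)} := by
    simp_rw [hτ]
    exact (measurableSet_le (measurable_partialSum hadapted t (Nat.le_succ _))
      measurable_const).inter
      (measurableSet_lt measurable_const (measurable_partialSum hadapted t le_rfl))
  have hweights (ν : ℕ) : ∑ _i : Fin (ν + 1), 1 / ((ν : ℝ) + 1) = 1 := by
    have hne : (ν : ℝ) + 1 ≠ 0 := by positivity
    simp [hne]
  have hy (ν t) : Measurable (y ν t) := by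
    refine Finset.measurable_sum _ fun i _ => Measurable.const_mul ?_ _
    exact Measurable.ite (ℱ.le t _ (hmeas ν i t)) measurable_const measurable_const
  have hbound (ν t ω) : |y ν t ω| ≤ 1 := by
    have hw : (0 : ℝ) ≤ 1 / ((ν : ℝ) + 1) := by positivity
    rw [abs_of_nonneg]
    · rw [← hweights ν]
      refine Finset.sum_le_sum fun i _ => mul_le_of_le_one_right hw ?_
      split_ifs <;> norm_num
    · refine Finset.sum_nonneg fun i _ => mul_nonneg hw ?_
      split_ifs <;> norm_num
  have hgrid (ν) (t : Fin (T + 1)) (ω) :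
      y ν t ω = gridCount ν (S ω (t + 1)) - gridCount ν (S ω t) := by
    have hmono : S ω t ≤ S ω (t + 1) := partialSum_mono _ (Nat.le_succ _)
    simp only [y, gridCount, hτ]
    rw [← Finset.sum_sub_distrib]
    refine Finset.sum_congr rfl fun i _ => ?_
    rw [← mul_sub]
    congr 1
    split_ifs <;> grind
  have hlim (t) : ∀ᵐ ω ∂P, Tendsto (fun ν => y ν t ω) atTop (𝓝 (x t ω)) := by
    filter_upwards [hx] with ω hω
    simp_rw [hgrid]
    have h (n : ℕ) : Tendsto (fun ν => gridCount ν (S ω n)) atTop (𝓝 (S ω n)) :=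
      tendsto_gridCount (partialSum_nonneg _ n) (partialSum_le_one hω.1 hω.2 n)
    have hsub := (h (t + 1)).sub (h t)
    rwa [show S ω (t + 1) - S ω t = x t ω from
      partialSum_succ_sub (x := fun s => x s ω) t (hω.1 t)] at hsub
  refine ⟨y, fun ν => ⟨ν + 1, fun _ => 1 / ((ν : ℝ) + 1), τ ν, hmeas ν, fun _ => by positivity,
    hweights ν, fun _ _ => rfl⟩, fun v hv => tendsto_integral_sum_mul hy hbound hlim hv, hlim⟩
end

section
/- (Dual representation of optimal stopping) Let (Ω,ℱ,P) be a probability space with a filtration (ℱ_t)_{t=0}^T and let Z = (Z_t)_{t=0}^T be a nonnegative integrable adapted real-valued process. Then sup{ E[Z_τ] : τ a stopping time of the filtration with values in {0,…,T} } = inf{ E[y_0] : y = (y_t)_{t=0}^T an integrable martingale of the filtration with y_t ≥ Z_t P-a.s. for all t }. -/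
open MeasureTheory Filter Topology

section StoppedFamily

variable {Ω ι : Type*} [Fintype ι]

lemma stopped_eq_sum_indicator (Z : ι → Ω → ℝ) (τ : Ω → ι) (ω : Ω) :
    Z (τ ω) ω = ∑ t, {ω | τ ω = t}.indicator (Z t) ω := by
  classical
  simp [Set.indicator_apply]

variable [mΩ : MeasurableSpace Ω] {P : Measure Ω}

lemma integrable_stopped {Z : ι → Ω → ℝ} {τ : Ω → ι} (hZ : ∀ t, Integrable (Z t) P)
    (hτ : ∀ t, MeasurableSet {ω | τ ω = t}) :
    Integrable (fun ω => Z (τ ω) ω) P := by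
  simp only [stopped_eq_sum_indicator Z τ]
  exact integrable_finsetSum _ fun t _ => (hZ t).indicator (hτ t)

lemma integral_stopped_eq_sum {Z : ι → Ω → ℝ} {τ : Ω → ι} (hZ : ∀ t, Integrable (Z t) P)
    (hτ : ∀ t, MeasurableSet {ω | τ ω = t}) :
    ∫ ω, Z (τ ω) ω ∂P = ∑ t, ∫ ω in {ω | τ ω = t}, Z t ω ∂P := by
  simp only [stopped_eq_sum_indicator Z τ]
  rw [integral_finsetSum _ fun t _ => (hZ t).indicator (hτ t)]
  exact Finset.sum_congr rfl fun t _ => integral_indicator (hτ t)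

end StoppedFamily

/-- Optional sampling for a martingale on a finite index set with a largest element. -/
lemma MeasureTheory.Martingale.integral_stopped_eq {Ω ι : Type*} [mΩ : MeasurableSpace Ω]
    {P : Measure Ω} [IsFiniteMeasure P] [Fintype ι] [PartialOrder ι] [OrderTop ι]
    {ℱ : Filtration ι mΩ} {y : ι → Ω → ℝ}
    (hy : Martingale y ℱ P) {τ : Ω → ι} (hτ : ∀ t, MeasurableSet[ℱ t] {ω | τ ω = t}) (i : ι) :
    ∫ ω, y (τ ω) ω ∂P = ∫ ω, y i ω ∂P := by
  have hτ' t : MeasurableSet {ω | τ ω = t} := ℱ.le t _ (hτ t)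
  have h_mean : ∫ ω, y i ω ∂P = ∫ ω, y ⊤ ω ∂P := by
    simpa using hy.setIntegral_eq (le_top : i ≤ ⊤) MeasurableSet.univ
  rw [h_mean, integral_stopped_eq_sum hy.integrable hτ',
    integral_stopped_eq_sum (Z := fun _ => y ⊤) (fun _ => hy.integrable ⊤) hτ']
  exact Finset.sum_congr rfl fun t _ => hy.setIntegral_eq le_top (hτ t)

/-- From every time `t` on there are an optimal stopping time `τ` and an optimal dual variable `X`,
whose conditional expectations dominate `Z` and which has the same value as `Z τ` at time `t`. -/
lemma exists_optimal_pair {Ω : Type*} [mΩ : MeasurableSpace Ω] (P : Measure Ω)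
    [IsFiniteMeasure P] {T : ℕ} (ℱ : Filtration (Fin (T + 1)) mΩ)
    {Z : Fin (T + 1) → Ω → ℝ} (hZ_adapted : ∀ t, Measurable[ℱ t] (Z t))
    (hZ_int : ∀ t, Integrable (Z t) P) (t : Fin (T + 1)) :
    ∃ (τ : Ω → Fin (T + 1)) (X : Ω → ℝ),
      (∀ s, MeasurableSet[ℱ s] {ω | τ ω = s}) ∧ (∀ ω, t ≤ τ ω) ∧ Integrable X P ∧
      (∀ s, t ≤ s → Z s ≤ᵐ[P] P[X | ℱ s]) ∧
      P[fun ω => Z (τ ω) ω | ℱ t] =ᵐ[P] P[X | ℱ t] := by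
  induction t using Fin.reverseInduction with
  | last =>
    refine ⟨fun _ => Fin.last T, Z (Fin.last T), fun s => MeasurableSet.const _, fun _ => le_rfl,
      hZ_int _, fun s hs => ?_, ae_eq_rfl⟩
    obtain rfl : s = Fin.last T := le_antisymm (Fin.le_last s) hs
    rw [condExp_of_stronglyMeasurable (ℱ.le _) (hZ_adapted _).stronglyMeasurable (hZ_int _)]
  | cast i ih =>
    classical
    obtain ⟨τ, X, hτ, hτ_ge, hX, hXZ, hval⟩ := ih
    set t := i.castSucc
    have ht_lt : t < i.succ := Fin.castSucc_lt_succ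
    set C := P[X | ℱ t] with hC
    have hC_meas : Measurable[ℱ t] C := stronglyMeasurable_condExp.measurable
    have hval_t : P[fun ω => Z (τ ω) ω | ℱ t] =ᵐ[P] C :=
      (condExp_condExp_of_le (ℱ.mono ht_lt.le) (ℱ.le _)).symm.trans
        ((condExp_congr_ae hval).trans (condExp_condExp_of_le (ℱ.mono ht_lt.le) (ℱ.le _)))
    set A : Set Ω := {ω | C ω ≤ Z t ω} with hA_def
    have hA : MeasurableSet[ℱ t] A :=
      measurableSet_le hC_meas (hZ_adapted t)
    set G : Ω → ℝ := A.indicator (Z t - C) with hG_def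
    have hG_nonneg : 0 ≤ G := fun ω => Set.indicator_nonneg (fun ω hω => sub_nonneg.2 hω) ω
    have hG_meas : StronglyMeasurable[ℱ t] G :=
      (((hZ_adapted t).sub hC_meas).indicator hA).stronglyMeasurable
    have hG_int : Integrable G P :=
      ((hZ_int t).sub integrable_condExp).indicator (ℱ.le t _ hA)
    have h_cond_add (s) (hs : t ≤ s) : P[X + G | ℱ s] =ᵐ[P] P[X | ℱ s] + G := by
      have h := condExp_add hX hG_int (ℱ s)
      rwa [condExp_of_stronglyMeasurable (ℱ.le s) (hG_meas.mono (ℱ.mono hs)) hG_int] at h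
    have hZτ_int : Integrable (fun ω => Z (τ ω) ω) P :=
      integrable_stopped hZ_int fun s => ℱ.le s _ (hτ s)
    refine ⟨A.piecewise (fun _ => t) τ, X + G, fun s => ?_, fun ω => ?_, hX.add hG_int,
      fun s hs => ?_, ?_⟩
    · have h_eq : {ω | A.piecewise (fun _ => t) τ ω = s} =
          A.ite {_ω | t = s} {ω | τ ω = s} := by
        ext ω
        by_cases hω : ω ∈ A <;> simp [Set.ite, hω]
      rw [h_eq]
      rcases le_or_gt t s with hs | hs
      · exact (ℱ.mono hs _ hA).ite (MeasurableSet.const _) (hτ s)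
      · have h1 : {_ω : Ω | t = s} = ∅ := by simp [hs.ne']
        have h2 : {ω : Ω | τ ω = s} = ∅ :=
          Set.eq_empty_of_forall_notMem fun ω hω =>
            ((hs.trans ht_lt).trans_le (hτ_ge ω)).ne' hω
        simp [h1, h2]
    · by_cases hω : ω ∈ A
      · simp [hω]
      · simpa [hω] using ht_lt.le.trans (hτ_ge ω)
    · rcases hs.eq_or_lt with rfl | hs'
      · filter_upwards [h_cond_add t le_rfl] with ω h
        rw [h, Pi.add_apply, ← hC]
        by_cases hω : ω ∈ A
        · simp [hG_def, hω]
        · have : Z t ω < C ω := not_le.1 hω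
          simp [hG_def, hω, this.le]
      · filter_upwards [h_cond_add s hs, hXZ s (Fin.castSucc_lt_iff_succ_le.1 hs')] with ω h h'
        rw [h, Pi.add_apply]
        exact h'.trans (le_add_of_nonneg_right (hG_nonneg ω))
    · have h_eq : (fun ω => Z (A.piecewise (fun _ => t) τ ω) ω) =
          A.indicator (Z t) + Aᶜ.indicator (fun ω => Z (τ ω) ω) := by
        ext ω
        by_cases hω : ω ∈ A <;> simp [hω]
      have h_stop : P[A.indicator (Z t) | ℱ t] = A.indicator (Z t) :=
        condExp_of_stronglyMeasurable (ℱ.le t) ((hZ_adapted t).indicator hA).stronglyMeasurable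
          ((hZ_int t).indicator (ℱ.le t _ hA))
      rw [h_eq]
      filter_upwards [condExp_add ((hZ_int t).indicator (ℱ.le t _ hA))
          (hZτ_int.indicator (ℱ.le t _ hA.compl)) (ℱ t),
        condExp_indicator hZτ_int hA.compl, hval_t, h_cond_add t le_rfl] with ω h1 h2 h3 h4
      rw [h1, h4, Pi.add_apply, Pi.add_apply, h_stop, h2, ← hC]
      by_cases hω : ω ∈ A <;> simp [hG_def, hω, h3]

/-- **Dual representation of optimal stopping**: the optimal stopping value of a
nonnegative integrable adapted process `Z` equals the minimal initial value `E[y_0]`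
over integrable martingales dominating `Z`. -/
theorem optimal_stopping_duality {Ω : Type*} [mΩ : MeasurableSpace Ω] (P : Measure Ω)
    [IsProbabilityMeasure P]
    (T : ℕ) (ℱ : Filtration (Fin (T + 1)) mΩ)
    (Z : Fin (T + 1) → Ω → ℝ)
    (hZ_adapted : ∀ t, Measurable[ℱ t] (Z t))
    (hZ_nonneg : ∀ t, ∀ᵐ ω ∂P, 0 ≤ Z t ω)
    (hZ_int : ∀ t, Integrable (Z t) P) :
    sSup {r : ℝ | ∃ τ : Ω → Fin (T + 1),
        (∀ t, MeasurableSet[ℱ t] {ω | τ ω = t}) ∧ r = ∫ ω, Z (τ ω) ω ∂P}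
      = sInf {r : ℝ | ∃ y : Fin (T + 1) → Ω → ℝ,
          (∀ t, Integrable (y t) P) ∧ Martingale y ℱ P ∧
          (∀ t, ∀ᵐ ω ∂P, Z t ω ≤ y t ω) ∧ r = ∫ ω, y 0 ω ∂P} := by
  set S := {r : ℝ | ∃ τ : Ω → Fin (T + 1),
    (∀ t, MeasurableSet[ℱ t] {ω | τ ω = t}) ∧ r = ∫ ω, Z (τ ω) ω ∂P}
  set D := {r : ℝ | ∃ y : Fin (T + 1) → Ω → ℝ,
    (∀ t, Integrable (y t) P) ∧ Martingale y ℱ P ∧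
    (∀ t, ∀ᵐ ω ∂P, Z t ω ≤ y t ω) ∧ r = ∫ ω, y 0 ω ∂P}
  have h_weak : ∀ r ∈ S, ∀ q ∈ D, r ≤ q := by
    rintro _ ⟨τ, hτ, rfl⟩ _ ⟨y, hy_int, hy, hZy, rfl⟩
    have hτ' t : MeasurableSet {ω | τ ω = t} := ℱ.le t _ (hτ t)
    rw [← hy.integral_stopped_eq hτ 0]
    refine integral_mono_ae (integrable_stopped hZ_int hτ') (integrable_stopped hy_int hτ') ?_
    filter_upwards [ae_all_iff.2 hZy] with ω h using h (τ ω)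
  obtain ⟨τ, X, hτ, -, -, hXZ, hval⟩ := exists_optimal_pair P ℱ hZ_adapted hZ_int 0
  have hS : (∫ ω, Z (τ ω) ω ∂P) ∈ S := ⟨τ, hτ, rfl⟩
  have hD : (∫ ω, Z (τ ω) ω ∂P) ∈ D := by
    refine ⟨fun t => P[X | ℱ t], fun _ => integrable_condExp, martingale_condExp X ℱ P,
      fun t => hXZ t (Fin.zero_le t), ?_⟩
    rw [← integral_congr_ae hval, integral_condExp (ℱ.le 0)]
  have h_sup : IsGreatest S (∫ ω, Z (τ ω) ω ∂P) := ⟨hS, fun r hr => h_weak r hr _ hD⟩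
  have h_inf : IsLeast D (∫ ω, Z (τ ω) ω ∂P) := ⟨hD, fun q hq => h_weak _ hS q hq⟩
  rw [h_sup.csSup_eq, h_inf.csInf_eq]
end
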